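/- Let n ≥ 1 and let Λ₀ ⊆ E = ℝⁿ × ℝⁿ be the set Λ₀ = { (x,ξ) : ‖x‖² + ‖ξ‖² = 1 and x, ξ are linearly dependent } ∪ { (0,ξ) : ‖ξ‖ ≤ 1 }. Let 0 < r < 1/√2. Then there do not exist an open interval I containing 0 and 1, a C^∞ map Φ : E × I → E and a C^∞ function h : E × I → ℝ such that Φ(·,0) = id_E, ∂Φ/∂s(p,s) = X_{h(·,s)}(Φ(p,s)) for all (p,s) ∈ E × I, and Φ(·,1)(Λ₀) ⊆ { (x,ξ) ∈ E : x₁² + ξ₁² ≤ r² }. (Nonsqueezing for the 'flying saucer' Lagrangian Λ₀.) -/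

import Mathlib

open scoped RealInnerProductSpace ContDiff

noncomputable section

/-- `E = ℝⁿ × ℝⁿ`. -/
abbrev Esp (n : ℕ) : Type := EuclideanSpace ℝ (Fin n) × EuclideanSpace ℝ (Fin n)

/-- The Hamiltonian vector field `X_h(x,ξ) = (∇_ξ h(x,ξ), −∇_x h(x,ξ))` of a function
`h : E → ℝ`. -/
def hamVF {n : ℕ} (h : Esp n → ℝ) (p : Esp n) : Esp n :=
  (gradient (fun η => h (p.1, η)) p.2, - gradient (fun y => h (y, p.2)) p.1)

/-- The "flying saucer" Lagrangian
`Λ₀ = {(x,ξ) : ‖x‖² + ‖ξ‖² = 1, x and ξ linearly dependent} ∪ {(0,ξ) : ‖ξ‖ ≤ 1}`. -/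
def saucer (n : ℕ) : Set (Esp n) :=
  {p | ‖p.1‖ ^ 2 + ‖p.2‖ ^ 2 = 1 ∧ ¬ LinearIndependent ℝ ![p.1, p.2]} ∪
  {p | p.1 = 0 ∧ ‖p.2‖ ≤ 1}

/-- A perturbation of the identity by a contraction is a homeomorphism. -/
theorem exists_homeomorph_id_add {X : Type*} [NormedAddCommGroup X] [NormedSpace ℝ X]
    [CompleteSpace X] {F : X → X} {K : NNReal} (hF : LipschitzWith K F) (hK : K < 1) :
    ∃ e : X ≃ₜ X, ∀ x, e x = x + F x := by
  have hA : ApproximatesLinearOn (fun x => x + F x)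
      ((ContinuousLinearEquiv.refl ℝ X : X ≃L[ℝ] X) : X →L[ℝ] X) Set.univ K := by
    intro x _ y _
    have := hF.dist_le_mul x y
    simp only [dist_eq_norm] at this
    simpa [add_sub_add_comm] using this
  have hc : Subsingleton X ∨
      K < ‖((ContinuousLinearEquiv.refl ℝ X).symm : X →L[ℝ] X)‖₊⁻¹ := by
    rcases subsingleton_or_nontrivial X with h | h
    · exact Or.inl h
    · right
      have h1 : ‖((ContinuousLinearEquiv.refl ℝ X).symm : X →L[ℝ] X)‖₊ = 1 := by
        ext
        have : ((ContinuousLinearEquiv.refl ℝ X).symm : X →L[ℝ] X)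
          = ContinuousLinearMap.id ℝ X := rfl
        rw [this]
        simp
      rw [h1]
      simpa using hK
  exact ⟨hA.toHomeomorph _ hc, fun x => rfl⟩

/-- A Lipschitz function dominated by a multiple of the identity is a bijective perturbation. -/
theorem bijective_smul_add {X : Type*} [NormedAddCommGroup X] [NormedSpace ℝ X]
    [CompleteSpace X] {F : X → X} {K : NNReal} (hF : LipschitzWith K F) {s : ℝ} (hs : K < s) :
    Function.Bijective (fun x => s • x + F x) := by
  have hs0 : 0 < s := lt_of_le_of_lt K.2 hs
  have hL : LipschitzWith (s⁻¹.toNNReal * K) (fun x => s⁻¹ • F x) := by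
    refine LipschitzWith.of_dist_le_mul fun x y => ?_
    rw [dist_smul₀, Real.norm_of_nonneg (by positivity)]
    have := hF.dist_le_mul x y
    rw [NNReal.coe_mul, Real.coe_toNNReal _ (by positivity), mul_assoc]
    gcongr
  obtain ⟨e, he⟩ := exists_homeomorph_id_add hL (by
    rw [← NNReal.coe_lt_coe]
    rw [NNReal.coe_mul, Real.coe_toNNReal _ (by positivity), NNReal.coe_one]
    rw [inv_mul_lt_iff₀ hs0]; simpa using hs)
  have : (fun x => s • x + F x) = (fun x => s • x) ∘ e := by
    ext x
    simp [he, smul_smul, mul_inv_cancel₀ hs0.ne']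
  rw [this]
  refine Function.Bijective.comp ?_ e.bijective
  exact (Homeomorph.smulOfNeZero s hs0.ne').bijective

theorem exists_weights_det (k : ℕ) (K : ℝ) :
    ∃ w : ℕ → ℝ, ∀ M : Matrix (Fin k) (Fin k) ℝ,
      M.det = ∑ i ∈ Finset.range (k + 1), w i * (((K + 1 + i : ℝ) • 1 + M).det) := by
  let v : ℕ → ℝ := fun i => K + 1 + i
  have hv : Set.InjOn v (Finset.range (k + 1)) := by
    intro a _ b _ hab
    simpa [v] using hab
  refine ⟨fun i => (Lagrange.basis (Finset.range (k + 1)) v i).eval 0, fun M => ?_⟩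
  have hev : ∀ t : ℝ, (-M).charpoly.eval t = (t • 1 + M).det := by
    intro t
    rw [Matrix.eval_charpoly, sub_neg_eq_add, Matrix.smul_one_eq_diagonal]
    rfl
  have hdeg : (-M).charpoly.degree < (Finset.range (k + 1)).card := by
    rw [Matrix.charpoly_degree_eq_dim]
    simp only [Fintype.card_fin, Finset.card_range]
    exact_mod_cast Nat.lt_succ_self k
  have h0 : (-M).charpoly.eval 0 = M.det := by rw [hev]; simp
  rw [← h0]
  conv_lhs => rw [Lagrange.eq_interpolate hv hdeg]
  rw [Lagrange.interpolate_apply, Polynomial.eval_finsetSum]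
  refine Finset.sum_congr rfl fun i _ => ?_
  rw [Polynomial.eval_mul, Polynomial.eval_C, hev, mul_comm]

theorem det_smul_one_add_pos {k : ℕ} {L : (Fin k → ℝ) →L[ℝ] (Fin k → ℝ)} {s : ℝ}
    (hs : ‖L‖ < s) : 0 < (s • ContinuousLinearMap.id ℝ (Fin k → ℝ) + L).det := by
  have hs0 : 0 < s := lt_of_le_of_lt (norm_nonneg _) hs
  set g : ℝ → ℝ := fun t => (s • ContinuousLinearMap.id ℝ (Fin k → ℝ) + t • L).det with hg
  have hcont : Continuous g := by
    have : Continuous (fun A : (Fin k → ℝ) →L[ℝ] (Fin k → ℝ) => A.det) :=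
      ContinuousLinearMap.continuous_det
    exact this.comp (by fun_prop)
  have hne : ∀ t ∈ Set.Icc (0 : ℝ) 1, g t ≠ 0 := by
    intro t ht h0
    have : ¬ Function.Injective (s • ContinuousLinearMap.id ℝ (Fin k → ℝ) + t • L) := by
      intro hinj
      have h1 : LinearMap.ker ((s • ContinuousLinearMap.id ℝ (Fin k → ℝ) + t • L :
        (Fin k → ℝ) →L[ℝ] (Fin k → ℝ)) : (Fin k → ℝ) →ₗ[ℝ] (Fin k → ℝ)) = ⊥ :=
        LinearMap.ker_eq_bot.2 hinj
      have h2 := LinearMap.bot_lt_ker_of_det_eq_zero (show LinearMap.det _ = 0 from h0)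
      rw [h1] at h2
      exact lt_irrefl _ h2
    apply this
    refine (injective_iff_map_eq_zero _).2 fun x hx => ?_
    by_contra hx0
    have h1 : s • x = - (t • L x) := by
      have : s • x + t • L x = 0 := by simpa using hx
      exact eq_neg_of_add_eq_zero_left this
    have h2 : s * ‖x‖ = t * ‖L x‖ := by
      have := congrArg norm h1
      rwa [norm_neg, norm_smul, norm_smul, Real.norm_of_nonneg hs0.le,
        Real.norm_of_nonneg ht.1] at this
    have h3 : t * ‖L x‖ ≤ 1 * (‖L‖ * ‖x‖) :=
      mul_le_mul ht.2 (L.le_opNorm x) (norm_nonneg _) zero_le_one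
    have h4 : 0 < ‖x‖ := norm_pos_iff.2 hx0
    nlinarith
  have hg0 : 0 < g 0 := by
    simp only [hg, zero_smul, add_zero]
    have h1 : (s • ContinuousLinearMap.id ℝ (Fin k → ℝ)).det
        = LinearMap.det (s • (LinearMap.id : (Fin k → ℝ) →ₗ[ℝ] (Fin k → ℝ))) := rfl
    rw [h1, LinearMap.det_smul, LinearMap.det_id]
    positivity
  have : 0 < g 1 := by
    by_contra hneg
    obtain ⟨t, ht, ht0⟩ := intermediate_value_Icc' (zero_le_one' ℝ) hcont.continuousOn
      (show (0:ℝ) ∈ Set.Icc (g 1) (g 0) from ⟨not_lt.1 hneg, hg0.le⟩)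
    exact hne t ht ht0
  simpa [hg] using this

open MeasureTheory in
/-- The Jacobian determinant is a null Lagrangian: its integral depends only on the values
near the boundary. -/
theorem integral_det_fderiv_eq {k : ℕ} {F H : (Fin k → ℝ) → (Fin k → ℝ)} {K : NNReal} {R : ℝ}
    (hF : ContDiff ℝ 1 F) (hH : ContDiff ℝ 1 H) (hFK : LipschitzWith K F)
    (hHK : LipschitzWith K H) (hFH : ∀ x, R < ‖x‖ → F x = H x) :
    ∫ x in Metric.closedBall 0 R, (fderiv ℝ F x).det
      = ∫ x in Metric.closedBall 0 R, (fderiv ℝ H x).det := by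
  set B : Set (Fin k → ℝ) := Metric.closedBall 0 R
  have hBm : MeasurableSet B := Metric.isClosed_closedBall.measurableSet
  obtain ⟨w, hw⟩ := exists_weights_det k K
  have hdet : ∀ L : (Fin k → ℝ) →L[ℝ] (Fin k → ℝ), L.det = ∑ i ∈ Finset.range (k + 1),
      w i * ((K + 1 + i : ℝ) • ContinuousLinearMap.id ℝ (Fin k → ℝ) + L).det := by
    intro L
    have key : ∀ A : (Fin k → ℝ) →L[ℝ] (Fin k → ℝ),
        A.det = (LinearMap.toMatrix' (A : (Fin k → ℝ) →ₗ[ℝ] (Fin k → ℝ))).det := by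
      intro A
      rw [LinearMap.det_toMatrix']
    rw [key L, hw]
    refine Finset.sum_congr rfl fun i _ => ?_
    rw [key]
    congr 2
    have : (((K + 1 + i : ℝ) • ContinuousLinearMap.id ℝ (Fin k → ℝ) + L :
        (Fin k → ℝ) →L[ℝ] (Fin k → ℝ)) : (Fin k → ℝ) →ₗ[ℝ] (Fin k → ℝ))
        = (K + 1 + i : ℝ) • LinearMap.id + (L : (Fin k → ℝ) →ₗ[ℝ] (Fin k → ℝ)) := rfl
    rw [this, map_add, map_smul, LinearMap.toMatrix'_id]
  have hcont : ∀ (G : (Fin k → ℝ) → (Fin k → ℝ)) (_ : ContDiff ℝ 1 G) (s : ℝ),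
      Continuous fun x => (s • ContinuousLinearMap.id ℝ (Fin k → ℝ) + fderiv ℝ G x).det := by
    intro G hG s
    have h1 : Continuous (fderiv ℝ G) := hG.continuous_fderiv (by norm_num)
    have : Continuous (fun A : (Fin k → ℝ) →L[ℝ] (Fin k → ℝ) => A.det) :=
      ContinuousLinearMap.continuous_det
    exact this.comp (by fun_prop)
  have hvol : ∀ (G : (Fin k → ℝ) → (Fin k → ℝ)) (_ : ContDiff ℝ 1 G) (_ : LipschitzWith K G)
      (s : ℝ) (_ : (K : ℝ) < s),
      ∫ x in B, (s • ContinuousLinearMap.id ℝ (Fin k → ℝ) + fderiv ℝ G x).det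
        = (volume : Measure (Fin k → ℝ)).real ((fun x => s • x + G x) '' B) := by
    intro G hG hGK s hs
    have hd : ∀ x ∈ B, HasFDerivWithinAt (fun x => s • x + G x)
        (s • ContinuousLinearMap.id ℝ (Fin k → ℝ) + fderiv ℝ G x) B x := by
      intro x _
      exact (((hasFDerivAt_id x).const_smul s).add
        (hG.differentiable (by norm_num) x).hasFDerivAt).hasFDerivWithinAt
    have h1 := integral_image_eq_integral_abs_det_fderiv_smul volume hBm hd
      (bijective_smul_add hGK hs).1.injOn (fun _ => (1 : ℝ))
    rw [setIntegral_const] at h1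
    simp only [smul_eq_mul, mul_one] at h1
    rw [h1]
    refine setIntegral_congr_fun hBm fun x _ => ?_
    exact (abs_of_pos (det_smul_one_add_pos
      (lt_of_le_of_lt (norm_fderiv_le_of_lipschitz ℝ hGK) hs))).symm
  have himg : ∀ s : ℝ, (K : ℝ) < s →
      (fun x => s • x + F x) '' B = (fun x => s • x + H x) '' B := by
    intro s hs
    have h1 := Set.image_compl_eq (s := B) (bijective_smul_add hFK hs)
    have h2 := Set.image_compl_eq (s := B) (bijective_smul_add hHK hs)
    have h3 : (fun x => s • x + F x) '' Bᶜ = (fun x => s • x + H x) '' Bᶜ := by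
      refine Set.image_congr fun x hx => ?_
      have : R < ‖x‖ := by simpa [B] using hx
      simp only [hFH x this]
    rw [h1, h2] at h3
    exact compl_injective h3
  have hexp : ∀ (G : (Fin k → ℝ) → (Fin k → ℝ)) (_ : ContDiff ℝ 1 G) (_ : LipschitzWith K G),
      ∫ x in B, (fderiv ℝ G x).det = ∑ i ∈ Finset.range (k + 1),
        w i * (volume : Measure (Fin k → ℝ)).real
          ((fun x => (K + 1 + i : ℝ) • x + G x) '' B) := by
    intro G hG hGK
    have : ∀ x, (fderiv ℝ G x).det = _ := fun x => hdet (fderiv ℝ G x)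
    simp_rw [this]
    rw [integral_finsetSum]
    · refine Finset.sum_congr rfl fun i _ => ?_
      rw [integral_const_mul, hvol G hG hGK]
      have : (0 : ℝ) ≤ i := Nat.cast_nonneg i
      linarith
    · intro i _
      exact ((hcont G hG _).continuousOn.integrableOn_compact
        (isCompact_closedBall _ _)).const_mul _
  rw [hexp F hF hFK, hexp H hH hHK]
  refine Finset.sum_congr rfl fun i _ => ?_
  rw [himg]
  have : (0 : ℝ) ≤ i := Nat.cast_nonneg i
  linarith

theorem ContDiff.lipschitzWith_id_add_of_hasCompactSupport {X : Type*} [NormedAddCommGroup X]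
    [NormedSpace ℝ X] [FiniteDimensional ℝ X] {v : X → X} (hv : ContDiff ℝ 1 v)
    (hc : HasCompactSupport v) : ∃ K : NNReal, LipschitzWith K (fun x => x + v x) := by
  obtain ⟨C, hC⟩ := hv.lipschitzWith_of_hasCompactSupport hc (by norm_num)
  exact ⟨1 + C, LipschitzWith.id.add hC⟩

/-- A continuous self-map of `ℝᵏ` equal to the identity outside a ball attains `0`. -/
theorem exists_eq_zero_of_eq_id_off_ball {k : ℕ} {f : (Fin k → ℝ) → (Fin k → ℝ)}
    (hf : Continuous f) {R : ℝ} (hR : 0 < R) (hid : ∀ x, R ≤ ‖x‖ → f x = x) :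
    ∃ x, f x = 0 := by
  by_contra! hne
  obtain ⟨ρ, hρ, hρR, hfρ⟩ : ∃ ρ : ℝ, 0 < ρ ∧ ρ ≤ R ∧ ∀ x, 2 * ρ ≤ ‖f x‖ := by
    obtain ⟨x₀, -, hx₀⟩ := (isCompact_closedBall (0 : Fin k → ℝ) R).exists_isMinOn
      ⟨0, by simpa using hR.le⟩ hf.norm.continuousOn
    have hpos : 0 < ‖f x₀‖ := norm_pos_iff.2 (hne x₀)
    refine ⟨min ‖f x₀‖ R / 2, by positivity, ?_, fun x => ?_⟩
    · have := min_le_right ‖f x₀‖ R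
      linarith
    · rw [mul_div_cancel₀ _ two_ne_zero]
      by_cases hx : ‖x‖ ≤ R
      · exact (min_le_left _ _).trans (hx₀ (by simpa using hx))
      · rw [hid x (not_le.1 hx).le]
        exact (min_le_right _ _).trans (not_le.1 hx).le
  obtain ⟨v, hv, hvf, hvs⟩ := (hf.sub continuous_id).exists_contDiff_approx 1
    (ε := fun _ => ρ) continuous_const (fun _ => hρ)
  have hv0 : ∀ x, R ≤ ‖x‖ → v x = 0 := by
    intro x hx
    by_contra h
    exact hvs h (by simp [hid x hx])
  have hvc : HasCompactSupport v := by
    refine HasCompactSupport.of_support_subset_isCompact (isCompact_closedBall 0 R) ?_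
    intro x hx
    by_contra h
    exact hx (hv0 x (by simpa using (not_le.1 (by simpa using h)).le))
  set F : (Fin k → ℝ) → (Fin k → ℝ) := fun x => x + v x with hF
  have hFρ : ∀ x, ρ ≤ ‖F x‖ := by
    intro x
    have h1 := hvf x
    rw [dist_eq_norm] at h1
    have h2 : f x = F x - (v x - (f x - x)) := by simp only [hF]; abel
    have h3 := norm_sub_le (F x) (v x - (f x - x))
    rw [← h2] at h3
    have h4 := hfρ x
    simp only [Pi.sub_apply, id_eq] at h1
    linarith
  set φ : ℝ → ℝ := fun t => max 0 (1 - |t| / ρ) with hφ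
  have hφc : Continuous φ := by fun_prop
  set g : ℝ → ℝ := fun s => ∫ t in (0 : ℝ)..s, φ t with hg
  have hgd : ∀ s, HasDerivAt g (φ s) s := fun s =>
    intervalIntegral.integral_hasDerivAt_right (hφc.intervalIntegrable _ _)
      hφc.aestronglyMeasurable.stronglyMeasurableAtFilter hφc.continuousAt
  have hg1 : ContDiff ℝ 1 g := by
    rw [contDiff_one_iff_deriv]
    refine ⟨fun s => (hgd s).differentiableAt, ?_⟩
    rw [show deriv g = φ from funext fun s => (hgd s).deriv]
    exact hφc
  have hφ1 : ∀ t, |φ t| ≤ 1 := by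
    intro t
    have : 0 ≤ |t| / ρ := by positivity
    rw [abs_of_nonneg (le_max_left _ _)]
    exact max_le zero_le_one (by linarith)
  have hgL : LipschitzWith 1 g := by
    refine lipschitzWith_of_nnnorm_deriv_le (fun s => (hgd s).differentiableAt) fun s => ?_
    rw [(hgd s).deriv, ← NNReal.coe_le_coe]
    simpa using hφ1 s
  set H : (Fin k → ℝ) → (Fin k → ℝ) := fun x i => g (x i) with hH
  have hHd : ContDiff ℝ 1 H := contDiff_pi.2 fun i => hg1.comp (contDiff_apply ℝ ℝ i)
  have hHL : LipschitzWith 1 H := by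
    refine LipschitzWith.of_dist_le_mul fun x y => ?_
    rw [NNReal.coe_one, one_mul, dist_pi_le_iff dist_nonneg]
    intro i
    have := hgL.dist_le_mul (x i) (y i)
    rw [NNReal.coe_one, one_mul] at this
    exact this.trans (dist_le_pi_dist x y i)
  have hHdet : ∀ y, (fderiv ℝ H y).det = ∏ i, φ (y i) := by
    intro y
    have h1 : HasFDerivAt H (ContinuousLinearMap.pi fun i =>
        φ (y i) • ContinuousLinearMap.proj (R := ℝ) (φ := fun _ : Fin k => ℝ) i) y := by
      rw [hasFDerivAt_pi]
      intro i
      have h2 := (hgd (y i)).comp_hasFDerivAt y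
        (ContinuousLinearMap.proj (R := ℝ) (φ := fun _ : Fin k => ℝ) i).hasFDerivAt
      exact h2
    rw [h1.fderiv]
    have h3 : (ContinuousLinearMap.pi fun i =>
        φ (y i) • ContinuousLinearMap.proj (R := ℝ) (φ := fun _ : Fin k => ℝ) i).det
        = LinearMap.det (Matrix.toLin' (Matrix.diagonal fun i => φ (y i))) := by
      rw [ContinuousLinearMap.det]
      congr 1
      ext i j
      simp [Matrix.mulVec_diagonal, Pi.single_apply]
    rw [h3, LinearMap.det_toLin', Matrix.det_diagonal]
  have hφ0 : ∀ y : Fin k → ℝ, ρ ≤ ‖y‖ → ∏ i, φ (y i) = 0 := by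
    intro y hy
    by_contra h
    rw [Finset.prod_eq_zero_iff] at h
    push Not at h
    have : ‖y‖ < ρ := by
      rw [pi_norm_lt_iff hρ]
      intro i
      have h1 := h i (Finset.mem_univ i)
      by_contra h2
      apply h1
      rw [hφ]
      refine max_eq_left ?_
      rw [Real.norm_eq_abs, not_lt] at h2
      have := (one_le_div hρ).2 h2
      linarith
    linarith
  obtain ⟨C, hFC⟩ := hv.lipschitzWith_id_add_of_hasCompactSupport hvc
  have hFd : ContDiff ℝ 1 F := contDiff_id.add hv
  have hcomp : ContDiff ℝ 1 (H ∘ F) := hHd.comp hFd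
  have key := integral_det_fderiv_eq (K := max (1 * C) 1) (R := R) hcomp hHd
    ((hHL.comp hFC).weaken (le_max_left _ _)) (hHL.weaken (le_max_right _ _)) (by
      intro x hx
      simp [hF, hv0 x hx.le])
  have hz : ∀ x, (fderiv ℝ (H ∘ F) x).det = 0 := by
    intro x
    rw [fderiv_comp x (hHd.differentiable (by norm_num) _) (hFd.differentiable (by norm_num) _)]
    have : ((fderiv ℝ H (F x)).comp (fderiv ℝ F x)).det
        = (fderiv ℝ H (F x)).det * (fderiv ℝ F x).det := by
      exact LinearMap.det_comp _ _
    rw [this, hHdet, hφ0 _ (hFρ x), zero_mul]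
  simp only [hz, hHdet, MeasureTheory.integral_zero] at key
  have hcont : Continuous fun x : Fin k → ℝ => ∏ i, φ (x i) := by fun_prop
  have hpos : 0 < ∫ x in Metric.closedBall (0 : Fin k → ℝ) R, ∏ i, φ (x i) := by
    rw [MeasureTheory.setIntegral_pos_iff_support_of_nonneg_ae]
    · refine lt_of_lt_of_le (Metric.measure_ball_pos MeasureTheory.volume (0 : Fin k → ℝ) hρ)
        (MeasureTheory.measure_mono ?_)
      intro x hx
      have hx' : ‖x‖ < ρ := by simpa using hx
      refine ⟨?_, by simpa using hx'.le.trans hρR⟩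
      refine (Finset.prod_pos fun i _ => ?_).ne'
      refine lt_max_of_lt_right ?_
      have h1 : |x i| < ρ := lt_of_le_of_lt (norm_le_pi_norm x i) hx'
      have := (div_lt_one hρ).2 h1
      linarith
    · exact Filter.Eventually.of_forall fun x => Finset.prod_nonneg fun i _ => le_max_left _ _
    · exact hcont.continuousOn.integrableOn_compact (isCompact_closedBall _ _)
  rw [← key] at hpos
  exact lt_irrefl _ hpos

/-- A continuous self-map of a finite-dimensional space equal to the identity outside a
bounded set is surjective. -/
theorem surjective_of_eq_id_off_bounded {X : Type*} [NormedAddCommGroup X] [NormedSpace ℝ X]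
    [FiniteDimensional ℝ X] {f : X → X} (hf : Continuous f) {R : ℝ}
    (hid : ∀ x, R < ‖x‖ → f x = x) : Function.Surjective f := by
  intro p
  let e : X ≃L[ℝ] (Fin (Module.finrank ℝ X) → ℝ) :=
    ContinuousLinearEquiv.ofFinrankEq (by simp)
  set E : X →L[ℝ] (Fin (Module.finrank ℝ X) → ℝ) := (e : X →L[ℝ] (Fin (Module.finrank ℝ X) → ℝ))
  obtain ⟨x, hx⟩ := exists_eq_zero_of_eq_id_off_ball
    (f := fun y => e (f (e.symm y + p) - p)) (R := ‖E‖ * (|R| + 1 + ‖p‖) + 1)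
    (by fun_prop) (by positivity) (by
      intro y hy
      have h1 : ‖y‖ ≤ ‖E‖ * ‖e.symm y‖ := by
        have := E.le_opNorm (e.symm y)
        simpa [E] using this
      have h2 : |R| + 1 + ‖p‖ < ‖e.symm y‖ := by
        by_contra h
        have := mul_le_mul_of_nonneg_left (not_lt.1 h) (norm_nonneg E)
        linarith
      have h3 : R < ‖e.symm y + p‖ := by
        have := norm_sub_le (e.symm y + p) p
        rw [add_sub_cancel_right] at this
        have := le_abs_self R
        linarith
      simp [hid _ h3])
  refine ⟨e.symm x + p, ?_⟩
  have := (map_eq_zero_iff e e.injective).1 hx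
  exact sub_eq_zero.1 this

/-- A `C¹` function whose derivative is bounded below off a bounded set and has no zeros admits
a continuous bounded vector field along which its derivative is `1`. -/
theorem exists_pseudoGradient {W : Type*} [NormedAddCommGroup W] [NormedSpace ℝ W]
    [FiniteDimensional ℝ W] {A : W → ℝ} (hA : ContDiff ℝ 1 A) {R : ℝ}
    (hPS : ∀ z, ‖fderiv ℝ A z‖ ≤ 1 → ‖z‖ ≤ R) (hcrit : ∀ z, fderiv ℝ A z ≠ 0) :
    ∃ (Y : W → W) (C : ℝ), Continuous Y ∧ 0 ≤ C ∧ (∀ z, ‖Y z‖ ≤ C) ∧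
      ∀ z, fderiv ℝ A z (Y z) = 1 := by
  have hdc : Continuous (fderiv ℝ A) := hA.continuous_fderiv (by norm_num)
  obtain ⟨δ, hδ, hδA⟩ : ∃ δ : ℝ, 0 < δ ∧ ∀ z, δ ≤ ‖fderiv ℝ A z‖ := by
    obtain ⟨x₀, -, hx₀⟩ := (isCompact_closedBall (0 : W) |R|).exists_isMinOn
      ⟨0, by simp⟩ hdc.norm.continuousOn
    refine ⟨min ‖fderiv ℝ A x₀‖ 1, lt_min (norm_pos_iff.2 (hcrit x₀)) one_pos, fun z => ?_⟩
    by_cases hz : ‖fderiv ℝ A z‖ ≤ 1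
    · exact (min_le_left _ _).trans
        (hx₀ (by simpa using (hPS z hz).trans (le_abs_self R)))
    · exact (min_le_right _ _).trans (not_le.1 hz).le
  let X := EuclideanSpace ℝ (Fin (Module.finrank ℝ W))
  let L : W ≃L[ℝ] X := toEuclidean
  let M : X →L[ℝ] W := (L.symm : X →L[ℝ] W)
  let N : W →L[ℝ] X := (L : W →L[ℝ] X)
  let g : W → X := fun z => (InnerProductSpace.toDual ℝ X).symm ((fderiv ℝ A z).comp M)
  have hgc : Continuous g :=
    (InnerProductSpace.toDual ℝ X).symm.continuous.comp (hdc.clm_comp continuous_const)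
  have hgi : ∀ z (v : X), ⟪g z, v⟫ = fderiv ℝ A z (M v) := by
    intro z v
    simp only [g]
    rw [InnerProductSpace.toDual_symm_apply]
    rfl
  have hgn : ∀ z, δ ≤ ‖g z‖ * ‖N‖ := by
    intro z
    refine (hδA z).trans (ContinuousLinearMap.opNorm_le_bound _ (by positivity) fun v => ?_)
    have h1 : fderiv ℝ A z v = ⟪g z, N v⟫ := by
      rw [hgi]
      simp [M, N]
    rw [h1, mul_assoc]
    exact (norm_inner_le_norm _ _).trans (by gcongr; exact N.le_opNorm v)
  have hg0 : ∀ z, 0 < ‖g z‖ := by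
    intro z
    rcases (norm_nonneg (g z)).eq_or_lt with h | h
    · have := hgn z
      rw [← h, zero_mul] at this
      linarith
    · exact h
  refine ⟨fun z => M ((‖g z‖ ^ 2)⁻¹ • g z), ‖M‖ * (‖N‖ / δ), ?_, by positivity, fun z => ?_,
    fun z => ?_⟩
  · exact M.continuous.comp
      (((hgc.norm.pow 2).inv₀ fun z => (pow_pos (hg0 z) 2).ne').smul hgc)
  · refine (M.le_opNorm _).trans ?_
    gcongr
    rw [norm_smul, norm_inv, norm_pow, norm_norm, pow_two, mul_inv, mul_assoc,
      inv_mul_cancel₀ (hg0 z).ne', mul_one, inv_le_iff_one_le_mul₀ (hg0 z), div_mul_eq_mul_div,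
      one_le_div hδ, mul_comm]
    exact hgn z
  · rw [← hgi, inner_smul_right, real_inner_self_eq_norm_sq]
    exact inv_mul_cancel₀ (pow_pos (hg0 z) 2).ne'

/-- Deformation lemma: in the absence of critical points, a bounded set can be continuously
pushed into a sublevel, keeping a lower sublevel fixed. -/
theorem exists_deformation {W : Type*} [NormedAddCommGroup W] [NormedSpace ℝ W]
    [FiniteDimensional ℝ W] {A : W → ℝ} (hA : ContDiff ℝ 1 A) {R : ℝ}
    (hPS : ∀ z, ‖fderiv ℝ A z‖ ≤ 1 → ‖z‖ ≤ R) (hcrit : ∀ z, fderiv ℝ A z ≠ 0)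
    {a b : ℝ} (hab : a < b) (R₁ : ℝ) :
    ∃ T : W → W, Continuous T ∧ (∀ z, A z ≤ a → T z = z) ∧ ∀ z, ‖z‖ ≤ R₁ → A (T z) ≤ b := by
  obtain ⟨Y, C, hYc, hC, hYC, hY1⟩ := exists_pseudoGradient hA hPS hcrit
  have hdc : Continuous (fderiv ℝ A) := hA.continuous_fderiv (by norm_num)
  obtain ⟨m₀, hm₀⟩ : ∃ m₀ : ℝ, ∀ z, ‖z‖ ≤ R₁ → A z ≤ m₀ := by
    obtain ⟨m₀, h⟩ := (isCompact_closedBall (0 : W) R₁).bddAbove_image hA.continuous.continuousOn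
    exact ⟨m₀, fun z hz => h ⟨z, by simpa using hz, rfl⟩⟩
  set Θ : ℝ := 2 * (|m₀| + |b|) + 1 with hΘ
  have hΘ0 : 0 < Θ := by positivity
  set R₂ : ℝ := R₁ + Θ * C + C
  obtain ⟨κ, hκ, hκA⟩ : ∃ κ > 0, ∀ z ∈ Metric.closedBall (0 : W) R₂,
      ∀ z' ∈ Metric.closedBall (0 : W) R₂, dist z z' < κ →
        dist (fderiv ℝ A z) (fderiv ℝ A z') < 1 / (2 * (C + 1)) :=
    Metric.uniformContinuousOn_iff.1 ((isCompact_closedBall (0 : W) R₂).uniformContinuousOn_of_continuous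
      hdc.continuousOn) _ (by positivity)
  obtain ⟨m, hm⟩ := exists_nat_gt (Θ * (C + 1) / κ + Θ)
  have hm0 : (0 : ℝ) < m := lt_trans (by positivity) hm
  set τ : ℝ := Θ / m with hτ
  have hτ0 : 0 < τ := by positivity
  have hτ1 : τ ≤ 1 := by
    rw [hτ, div_le_one hm0]
    have : 0 ≤ Θ * (C + 1) / κ := by positivity
    linarith
  have hτκ : τ * (C + 1) < κ := by
    have h1 : Θ * (C + 1) / κ < m := by linarith
    rw [div_lt_iff₀ hκ] at h1
    rw [hτ, div_mul_eq_mul_div, div_lt_iff₀ hm0]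
    linarith
  set β : ℝ → ℝ := fun s => max 0 (min 1 ((s - a) / (b - a))) with hβ
  have hβc : Continuous β := by fun_prop
  have hβ0 : ∀ s, 0 ≤ β s := fun s => le_max_left _ _
  have hβ1 : ∀ s, β s ≤ 1 := fun s => max_le zero_le_one (min_le_left _ _)
  have hβa : ∀ s, s ≤ a → β s = 0 := by
    intro s hs
    refine max_eq_left ((min_le_right _ _).trans ?_)
    exact div_nonpos_of_nonpos_of_nonneg (by linarith) (by linarith)
  have hβb : ∀ s, b ≤ s → β s = 1 := by
    intro s hs
    have h1 : 1 ≤ (s - a) / (b - a) := by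
      rw [one_le_div (by linarith)]
      linarith
    simp [hβ, min_eq_left h1]
  set P : W → W := fun z => z - (τ * β (A z)) • Y z with hP
  have hPc : Continuous P :=
    continuous_id.sub ((continuous_const.mul (hβc.comp hA.continuous)).smul hYc)
  have hPn : ∀ z, ‖P z - z‖ ≤ τ * C := by
    intro z
    have : P z - z = -((τ * β (A z)) • Y z) := by simp [hP]
    rw [this, norm_neg, norm_smul, Real.norm_of_nonneg (mul_nonneg hτ0.le (hβ0 _))]
    calc τ * β (A z) * ‖Y z‖ ≤ τ * 1 * C := by
          gcongr
          · exact hβ1 _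
          · exact hYC z
      _ = τ * C := by ring
  have hPA : ∀ z, ‖z‖ ≤ R₁ + Θ * C → A (P z) ≤ A z - τ * β (A z) / 2 := by
    intro z hz
    have hball : Metric.closedBall z (τ * C) ⊆ Metric.closedBall 0 R₂ := by
      refine Metric.closedBall_subset_closedBall' ?_
      rw [dist_zero_right]
      have : τ * C ≤ 1 * C := by gcongr
      simp only [R₂]
      linarith
    have hzz : z ∈ Metric.closedBall z (τ * C) := Metric.mem_closedBall_self (by positivity)
    have h1 := (convex_closedBall z (τ * C)).norm_image_sub_le_of_norm_hasFDerivWithin_le'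
      (f := A) (f' := fderiv ℝ A) (φ := fderiv ℝ A z) (C := 1 / (2 * (C + 1)))
      (fun x _ => (hA.differentiable (by norm_num) x).hasFDerivAt.hasFDerivWithinAt)
      (fun x hx => by
        rw [← dist_eq_norm]
        refine (hκA x (hball hx) z (hball hzz) (lt_of_le_of_lt hx ?_)).le
        nlinarith)
      hzz (show P z ∈ Metric.closedBall z (τ * C) by
        rw [Metric.mem_closedBall, dist_eq_norm]; exact hPn z)
    have h2 : P z - z = -((τ * β (A z)) • Y z) := by simp [hP]
    rw [h2, map_neg, map_smul, hY1, norm_neg, norm_smul,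
      Real.norm_of_nonneg (mul_nonneg hτ0.le (hβ0 _))] at h1
    have h3 : 1 / (2 * (C + 1)) * (τ * β (A z) * ‖Y z‖) ≤ τ * β (A z) / 2 := by
      have h4 : τ * β (A z) * ‖Y z‖ ≤ τ * β (A z) * (C + 1) := by
        have := hβ0 (A z)
        gcongr
        linarith [hYC z]
      calc 1 / (2 * (C + 1)) * (τ * β (A z) * ‖Y z‖)
          ≤ 1 / (2 * (C + 1)) * (τ * β (A z) * (C + 1)) := by gcongr
        _ = τ * β (A z) / 2 := by field_simp
    have h5 := (Real.norm_eq_abs _ ▸ le_abs_self _).trans (h1.trans h3)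
    simp only [smul_eq_mul, mul_one] at h5
    linarith
  refine ⟨P^[m], hPc.iterate m, fun z hz => ?_, fun z hz => ?_⟩
  · have : P z = z := by simp [hP, hβa _ hz]
    exact Function.iterate_fixed this m
  · have key : ∀ j : ℕ, j ≤ m → ‖P^[j] z‖ ≤ R₁ + j * τ * C ∧
        A (P^[j] z) ≤ max b (m₀ - j * τ / 2) := by
      intro j
      induction j with
      | zero =>
        intro _
        simpa using ⟨hz, Or.inr (hm₀ z hz)⟩
      | succ j ih =>
        intro hj
        obtain ⟨ih1, ih2⟩ := ih (by omega)
        have hjm : (j : ℝ) ≤ m := by exact_mod_cast (show j ≤ m by omega)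
        rw [Function.iterate_succ_apply']
        set y := P^[j] z
        have hjτ : j * τ * C ≤ Θ * C := by
          have : (j : ℝ) * τ ≤ m * τ := by gcongr
          have h2 : m * τ = Θ := by rw [hτ]; field_simp
          rw [h2] at this
          gcongr
        refine ⟨?_, ?_⟩
        · have h1 := norm_le_norm_add_norm_sub' (P y) y
          have h2 := hPn y
          push_cast
          linarith
        · have h1 := hPA y (by linarith)
          push_cast
          by_cases hb : b ≤ A y
          · rw [hβb _ hb] at h1
            rcases le_max_iff.1 ih2 with h | h
            · refine le_max_of_le_left ?_
              linarith
            · refine le_max_of_le_right ?_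
              linarith
          · refine le_max_of_le_left ?_
            have := mul_nonneg hτ0.le (hβ0 (A y))
            linarith
    have h := (key m le_rfl).2
    have h2 : m * τ = Θ := by rw [hτ]; field_simp
    rw [h2] at h
    refine h.trans (max_le le_rfl ?_)
    have := le_abs_self m₀
    have := neg_abs_le b
    rw [hΘ]
    linarith

/-- A linking theorem: `A` is nonpositive on the boundary of a piece of `ι(Q)`, positive on the
fibre of `π` over `p`, and satisfies a compactness condition; then it has a critical point. -/
theorem exists_fderiv_eq_zero_of_linking {W Q : Type*} [NormedAddCommGroup W] [NormedSpace ℝ W]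
    [FiniteDimensional ℝ W] [NormedAddCommGroup Q] [NormedSpace ℝ Q] [FiniteDimensional ℝ Q]
    {A : W → ℝ} (hA : ContDiff ℝ 1 A) {R : ℝ} (hPS : ∀ z, ‖fderiv ℝ A z‖ ≤ 1 → ‖z‖ ≤ R)
    {ι : Q → W} {π : W → Q} {U : Q → ℝ} (hι : Continuous ι) (hπ : Continuous π)
    (hU : Continuous U) (hπι : ∀ q, π (ι q) = q) {r : ℝ}
    (hbd : ∀ q, U q = 0 → A (ι q) ≤ 0) (hcpt : ∀ q, 0 ≤ U q → 0 < A (ι q) → ‖q‖ ≤ r)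
    {p : Q} (hp : 0 ≤ U p) {b : ℝ} (hb : 0 < b) (hpb : ∀ z, π z = p → b ≤ A z) :
    ∃ z, fderiv ℝ A z = 0 := by
  by_contra! hcrit
  obtain ⟨R₁, hR₁⟩ : ∃ R₁ : ℝ, ∀ q, ‖q‖ ≤ r → ‖ι q‖ ≤ R₁ := by
    obtain ⟨m₀, h⟩ := (isCompact_closedBall (0 : Q) r).bddAbove_image hι.norm.continuousOn
    exact ⟨m₀, fun z hz => h ⟨z, by simpa using hz, rfl⟩⟩
  obtain ⟨T, hTc, hT0, hTb⟩ := exists_deformation hA hPS hcrit (half_pos hb) R₁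
  have hfix : ∀ q, A (ι q) ≤ 0 → π (T (ι q)) = q := fun q hq => by rw [hT0 _ hq, hπι]
  classical
  set f : Q → Q := fun q => if 0 ≤ U q then π (T (ι q)) else q with hf
  have hfc : Continuous f := by
    refine Continuous.if (fun q hq => ?_) (hπ.comp (hTc.comp hι)) continuous_id
    have : U q = 0 := by
      have h1 : frontier {q | (0 : ℝ) ≤ U q} ⊆ {q | 0 = U q} :=
        frontier_le_subset_eq continuous_const hU
      exact (h1 hq).symm
    exact hfix q (hbd q this)
  have hfid : ∀ q, r < ‖q‖ → f q = q := by
    intro q hq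
    simp only [hf]
    split_ifs with h
    · refine hfix q (not_lt.1 fun h2 => ?_)
      exact absurd (hcpt q h h2) (not_le.2 hq)
    · rfl
  obtain ⟨q, hq⟩ := surjective_of_eq_id_off_bounded hfc hfid p
  simp only [hf] at hq
  split_ifs at hq with h
  · have h1 := hpb _ hq
    by_cases hqr : ‖q‖ ≤ r
    · have := hTb _ (hR₁ q hqr)
      linarith
    · have h2 : A (ι q) ≤ 0 := not_lt.1 fun h2 => hqr (hcpt q h h2)
      rw [hT0 _ h2] at h1
      linarith
  · exact h (hq ▸ hp)

namespace FlyingSaucer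

/-- The profile of the saucer: the unit circle `σ = √(1 - t²)`, continued below zero. -/
def prof (t : ℝ) : ℝ := √(1 - t ^ 2) + min 0 (1 - t ^ 2)

/-- The primitive of the profile. -/
def primProf (t : ℝ) : ℝ := ∫ s in (0 : ℝ)..t, prof s

theorem continuous_prof : Continuous prof := by unfold prof; fun_prop

theorem hasDerivAt_primProf (t : ℝ) : HasDerivAt primProf (prof t) t :=
  intervalIntegral.integral_hasDerivAt_right (continuous_prof.intervalIntegrable _ _)
    continuous_prof.aestronglyMeasurable.stronglyMeasurableAtFilter continuous_prof.continuousAt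

theorem contDiff_primProf : ContDiff ℝ 1 primProf := by
  rw [contDiff_one_iff_deriv]
  refine ⟨fun s => (hasDerivAt_primProf s).differentiableAt, ?_⟩
  rw [show deriv primProf = prof from funext fun s => (hasDerivAt_primProf s).deriv]
  exact continuous_prof

theorem prof_le_one (t : ℝ) : prof t ≤ 1 := by
  have h1 : √(1 - t ^ 2) ≤ 1 := Real.sqrt_le_one.2 (by nlinarith [sq_nonneg t])
  have := min_le_left 0 (1 - t ^ 2)
  unfold prof
  linarith

theorem prof_le_two_sub_sq (t : ℝ) : prof t ≤ 2 - t ^ 2 := by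
  unfold prof
  rcases le_total 0 (1 - t ^ 2) with h | h
  · have h1 : √(1 - t ^ 2) ≤ 1 := Real.sqrt_le_one.2 (by nlinarith [sq_nonneg t])
    rw [min_eq_left h]
    linarith
  · rw [Real.sqrt_eq_zero_of_nonpos h, min_eq_right h]
    linarith

theorem sq_le_two_of_neg_one_le_prof {t : ℝ} (h : -1 ≤ prof t) : t ^ 2 ≤ 2 := by
  have := prof_le_two_sub_sq t
  rcases le_total 0 (1 - t ^ 2) with h1 | h1
  · linarith
  · unfold prof at h
    rw [Real.sqrt_eq_zero_of_nonpos h1, min_eq_right h1] at h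
    linarith

theorem sq_add_sq_eq_one_of_prof_eq {t s : ℝ} (hs : 0 < s) (h : prof t = s) :
    s ^ 2 + t ^ 2 = 1 := by
  unfold prof at h
  rcases le_total 0 (1 - t ^ 2) with h1 | h1
  · rw [min_eq_left h1, add_zero] at h
    rw [← h, Real.sq_sqrt h1]
    ring
  · rw [Real.sqrt_eq_zero_of_nonpos h1, min_eq_right h1] at h
    linarith

theorem primProf_sub_primProf (a b : ℝ) : primProf b - primProf a = ∫ s in a..b, prof s :=
  intervalIntegral.integral_interval_sub_left (continuous_prof.intervalIntegrable _ _)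
    (continuous_prof.intervalIntegrable _ _)

theorem primProf_one_sub : primProf 1 - primProf (-1) = Real.pi / 2 := by
  rw [primProf_sub_primProf, ← integral_sqrt_one_sub_sq]
  refine intervalIntegral.integral_congr fun t ht => ?_
  rw [Set.uIcc_of_le (by norm_num)] at ht
  have : 0 ≤ 1 - t ^ 2 := by nlinarith [ht.1, ht.2]
  simp [prof, min_eq_left this]

theorem primProf_sub_le {a b : ℝ} (hab : a ≤ b) : primProf b - primProf a ≤ b - a := by
  rw [primProf_sub_primProf]
  have := intervalIntegral.integral_mono_on (μ := MeasureTheory.volume) hab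
    (continuous_prof.intervalIntegrable a b)
    (continuous_const.intervalIntegrable a b) fun t _ => prof_le_one t
  simpa using this

theorem primProf_sub_le_cubic {a b : ℝ} (hab : a ≤ b) :
    primProf b - primProf a ≤ (b - a) * (2 - (a ^ 2 + a * b + b ^ 2) / 3) := by
  rw [primProf_sub_primProf]
  have h1 := intervalIntegral.integral_mono_on (μ := MeasureTheory.volume) hab
    (continuous_prof.intervalIntegrable a b)
    ((by fun_prop : Continuous fun t : ℝ => 2 - t ^ 2).intervalIntegrable a b)
    fun t _ => prof_le_two_sub_sq t
  refine h1.trans_eq ?_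
  rw [intervalIntegral.integral_sub (by simp) (by simp)]
  simp only [intervalIntegral.integral_const, smul_eq_mul, integral_pow]
  push_cast
  ring

/-- A smoothing of the Euclidean norm. -/
def smoothNorm {n : ℕ} (ε : ℝ) (x : EuclideanSpace ℝ (Fin n)) : ℝ := √(‖x‖ ^ 2 + ε ^ 2)

section
variable {n : ℕ} {ε : ℝ}

theorem smoothNorm_pos (hε : 0 < ε) (x : EuclideanSpace ℝ (Fin n)) : 0 < smoothNorm ε x :=
  Real.sqrt_pos.2 (by positivity)

theorem smoothNorm_sq (x : EuclideanSpace ℝ (Fin n)) : smoothNorm ε x ^ 2 = ‖x‖ ^ 2 + ε ^ 2 :=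
  Real.sq_sqrt (by positivity)

theorem norm_le_smoothNorm (x : EuclideanSpace ℝ (Fin n)) : ‖x‖ ≤ smoothNorm ε x :=
  Real.le_sqrt_of_sq_le (by nlinarith [sq_nonneg ε])

theorem contDiff_smoothNorm (hε : 0 < ε) :
    ContDiff ℝ 1 (smoothNorm ε : EuclideanSpace ℝ (Fin n) → ℝ) := by
  unfold smoothNorm
  exact ((contDiff_norm_sq ℝ).add contDiff_const).sqrt fun x => by positivity

theorem hasDerivAt_smoothNorm_line (hε : 0 < ε) (x v : EuclideanSpace ℝ (Fin n)) :
    HasDerivAt (fun t : ℝ => smoothNorm ε (x + t • v)) ⟪(smoothNorm ε x)⁻¹ • x, v⟫ 0 := by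
  have h1 : HasDerivAt (fun t : ℝ => x + t • v) v 0 := by
    simpa using ((hasDerivAt_id (0 : ℝ)).smul_const v).const_add x
  have h2 := (h1.norm_sq.add_const (ε ^ 2)).sqrt (by
    have : 0 < ‖x‖ ^ 2 + ε ^ 2 := by positivity
    simpa using this.ne')
  refine h2.congr_deriv ?_
  simp only [zero_smul, add_zero, inner_smul_left, smoothNorm]
  simp only [map_inv₀, conj_trivial]
  rw [mul_div_mul_left _ _ two_ne_zero, div_eq_inv_mul]

theorem smoothNorm_sub (hε : 0 < ε) (x y : EuclideanSpace ℝ (Fin n)) :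
    smoothNorm ε y - smoothNorm ε x
      = ⟪(smoothNorm ε x + smoothNorm ε y)⁻¹ • (x + y), y - x⟫ := by
  have h1 := smoothNorm_pos hε x
  have h2 := smoothNorm_pos hε y
  have h3 : ⟪x + y, y - x⟫ = smoothNorm ε y ^ 2 - smoothNorm ε x ^ 2 := by
    rw [smoothNorm_sq, smoothNorm_sq, inner_add_left, inner_sub_right, inner_sub_right,
      real_inner_self_eq_norm_sq, real_inner_self_eq_norm_sq, real_inner_comm x y]
    ring
  rw [inner_smul_left, h3]
  simp only [map_inv₀, conj_trivial]
  field_simp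
  ring

end

section

variable {n : ℕ}

theorem inner_hamVF_fst {G : Esp n → ℝ} {p : Esp n} (hG : DifferentiableAt ℝ G p)
    (v : EuclideanSpace ℝ (Fin n)) : ⟪(hamVF G p).1, v⟫ = fderiv ℝ G p (0, v) := by
  have h1 : HasFDerivAt (fun η => G (p.1, η))
      ((fderiv ℝ G p).comp (ContinuousLinearMap.inr ℝ _ _)) p.2 :=
    HasFDerivAt.comp (f := fun η => (p.1, η)) p.2 hG.hasFDerivAt (hasFDerivAt_prodMk_right _ _)
  simp [hamVF, gradient, h1.fderiv]

theorem inner_hamVF_snd {G : Esp n → ℝ} {p : Esp n} (hG : DifferentiableAt ℝ G p)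
    (v : EuclideanSpace ℝ (Fin n)) : ⟪(hamVF G p).2, v⟫ = -fderiv ℝ G p (v, 0) := by
  have h1 : HasFDerivAt (fun y => G (y, p.2))
      ((fderiv ℝ G p).comp (ContinuousLinearMap.inl ℝ _ _)) p.1 :=
    HasFDerivAt.comp (f := fun y => (y, p.2)) p.1 hG.hasFDerivAt (hasFDerivAt_prodMk_left _ _)
  simp [hamVF, gradient, h1.fderiv]

theorem norm_inv_smoothNorm_smul_le {ε : ℝ} (hε : 0 < ε) (x : EuclideanSpace ℝ (Fin n)) :
    ‖(smoothNorm ε x)⁻¹ • x‖ ≤ 1 := by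
  have h := smoothNorm_pos hε x
  rw [norm_smul, norm_inv, Real.norm_of_nonneg h.le, inv_mul_le_iff₀ h, mul_one]
  exact norm_le_smoothNorm x

/-- The configuration space of discrete paths `(x₀, d, ξ, η, η')`. -/
abbrev PathSp (n N : ℕ) : Type :=
  EuclideanSpace ℝ (Fin n) × (Fin N → EuclideanSpace ℝ (Fin n)) ×
    (Fin N → EuclideanSpace ℝ (Fin n)) × ℝ × ℝ

/-- The `k`-th node `x₀ + ∑_{i < k} d i` of a discrete path. -/
def node {N : ℕ} (k : ℕ) (x : EuclideanSpace ℝ (Fin n)) (d : Fin N → EuclideanSpace ℝ (Fin n)) :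
    EuclideanSpace ℝ (Fin n) :=
  x + ∑ i : Fin N, if (i : ℕ) < k then d i else 0

/-- The discrete action functional with boundary terms. -/
def action {N : ℕ} (G : Esp n → ℝ) (ε τ : ℝ) (z : PathSp n N) : ℝ :=
  primProf z.2.2.2.1 - z.2.2.2.1 * smoothNorm ε (node 0 z.1 z.2.1)
    - (primProf z.2.2.2.2 - z.2.2.2.2 * smoothNorm ε (node N z.1 z.2.1))
    + ∑ k : Fin N, (⟪z.2.2.1 k, z.2.1 k⟫ - τ * G (node k z.1 z.2.1, z.2.2.1 k))

variable {N : ℕ}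

theorem node_zero (x : EuclideanSpace ℝ (Fin n)) (d : Fin N → EuclideanSpace ℝ (Fin n)) :
    node 0 x d = x := by simp [node]

theorem node_top (x : EuclideanSpace ℝ (Fin n)) (d : Fin N → EuclideanSpace ℝ (Fin n)) :
    node N x d = x + ∑ i, d i := by simp [node]

theorem node_succ (k : Fin N) (x : EuclideanSpace ℝ (Fin n))
    (d : Fin N → EuclideanSpace ℝ (Fin n)) : node (k + 1) x d = node k x d + d k := by
  simp only [node, add_assoc, add_right_inj]
  rw [← Finset.sum_erase_add _ _ (Finset.mem_univ k),
    ← Finset.sum_erase_add Finset.univ (fun i : Fin N => if (i : ℕ) < k then d i else 0)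
      (Finset.mem_univ k)]
  simp only [lt_add_iff_pos_right, zero_lt_one, if_true, lt_irrefl, if_false, add_zero,
    add_left_inj]
  refine Finset.sum_congr rfl fun i hi => ?_
  have : (i : ℕ) ≠ k := fun h => Finset.ne_of_mem_erase hi (Fin.ext h)
  simp only [show ((i : ℕ) < k + 1) ↔ (i : ℕ) < k by omega]

theorem node_add_smul (k : ℕ) (x v : EuclideanSpace ℝ (Fin n))
    (d e : Fin N → EuclideanSpace ℝ (Fin n)) (t : ℝ) :
    node k (x + t • v) (d + t • e) = node k x d + t • node k v e := by
  simp only [node, smul_add, Finset.smul_sum, Pi.add_apply, Pi.smul_apply]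
  rw [add_add_add_comm, ← Finset.sum_add_distrib]
  congr 1
  refine Finset.sum_congr rfl fun i _ => ?_
  split_ifs <;> simp

theorem node_single (k : ℕ) (j : Fin N) (v : EuclideanSpace ℝ (Fin n)) :
    node k 0 (Pi.single j v) = if (j : ℕ) < k then v else 0 := by
  simp only [node, zero_add]
  rw [Finset.sum_eq_single j (fun i _ hi => by simp [hi]) (by simp)]
  simp

theorem contDiff_node (k : ℕ) :
    ContDiff ℝ 1 fun z : PathSp n N => node k z.1 z.2.1 := by
  unfold node
  refine contDiff_fst.add (ContDiff.sum fun i _ => ?_)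
  split_ifs
  · fun_prop
  · fun_prop

theorem contDiff_action {G : Esp n → ℝ} (hG : ContDiff ℝ 1 G) {ε : ℝ} (hε : 0 < ε) (τ : ℝ) :
    ContDiff ℝ 1 (action G ε τ : PathSp n N → ℝ) := by
  unfold action
  have h1 (k : ℕ) := (contDiff_smoothNorm hε).comp (contDiff_node (n := n) (N := N) k)
  have h2 : ContDiff ℝ 1 fun z : PathSp n N => primProf z.2.2.2.1 :=
    contDiff_primProf.comp (by fun_prop)
  have h3 : ContDiff ℝ 1 fun z : PathSp n N => primProf z.2.2.2.2 :=
    contDiff_primProf.comp (by fun_prop)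
  have hs (k : Fin N) : ContDiff ℝ 1 fun z : PathSp n N => z.2.2.1 k :=
    (contDiff_apply ℝ _ k).comp (by fun_prop)
  have hd (k : Fin N) : ContDiff ℝ 1 fun z : PathSp n N => z.2.1 k :=
    (contDiff_apply ℝ _ k).comp (by fun_prop)
  refine ((h2.sub (ContDiff.mul (by fun_prop) (h1 0))).sub
    (h3.sub (ContDiff.mul (by fun_prop) (h1 N)))).add (ContDiff.sum fun k _ => ?_)
  exact ((hs k).inner ℝ (hd k)).sub
    (contDiff_const.mul (hG.comp ((contDiff_node (k : ℕ)).prodMk (hs k))))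

theorem fderiv_action {G : Esp n → ℝ} (hG : ContDiff ℝ 1 G) {ε : ℝ} (hε : 0 < ε) (τ : ℝ)
    (z w : PathSp n N) :
    fderiv ℝ (action G ε τ) z w =
      (prof z.2.2.2.1 - smoothNorm ε z.1) * w.2.2.2.1
      - z.2.2.2.1 * ⟪(smoothNorm ε z.1)⁻¹ • z.1, w.1⟫
      - ((prof z.2.2.2.2 - smoothNorm ε (node N z.1 z.2.1)) * w.2.2.2.2
        - z.2.2.2.2 * ⟪(smoothNorm ε (node N z.1 z.2.1))⁻¹ • node N z.1 z.2.1,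
            node N w.1 w.2.1⟫)
      + ∑ k : Fin N, (⟪z.2.2.1 k, w.2.1 k⟫ + ⟪w.2.2.1 k, z.2.1 k⟫
        - τ * fderiv ℝ G (node k z.1 z.2.1, z.2.2.1 k) (node k w.1 w.2.1, w.2.2.1 k)) := by
  have h0 := (((contDiff_action hG hε τ).differentiable (by norm_num) z).hasFDerivAt
    |>.hasLineDerivAt w)
  refine HasDerivAt.unique h0 ?_
  have hl (c e : ℝ) : HasDerivAt (fun t : ℝ => c + t * e) e 0 := by
    simpa using ((hasDerivAt_id (0 : ℝ)).mul_const e).const_add c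
  have hv (c e : EuclideanSpace ℝ (Fin n)) : HasDerivAt (fun t : ℝ => c + t • e) e 0 := by
    simpa using ((hasDerivAt_id (0 : ℝ)).smul_const e).const_add c
  have hp (c e : ℝ) : HasDerivAt (fun t : ℝ => primProf (c + t * e)) (prof c * e) 0 := by
    refine HasDerivAt.comp (h₂ := primProf) (0 : ℝ) ?_ (hl c e)
    simpa using hasDerivAt_primProf c
  simp only [action, Prod.fst_add, Prod.snd_add, Prod.smul_fst, Prod.smul_snd, node_add_smul,
    smul_eq_mul, Pi.add_apply, Pi.smul_apply]
  have hn (k : ℕ) (c e : ℝ) := (hl c e).mul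
    (hasDerivAt_smoothNorm_line hε (node k z.1 z.2.1) (node k w.1 w.2.1))
  have hk (k : Fin N) := ((hv (z.2.2.1 k) (w.2.2.1 k)).inner ℝ
    (hv (z.2.1 k) (w.2.1 k))).sub
    (HasDerivAt.const_mul τ (HasFDerivAt.comp_hasDerivAt (l := G) (0 : ℝ)
      (l' := fderiv ℝ G (node k z.1 z.2.1, z.2.2.1 k))
      (by simpa using (hG.differentiable (by norm_num) _).hasFDerivAt)
      ((hv (node k z.1 z.2.1) (node k w.1 w.2.1)).prodMk (hv (z.2.2.1 k) (w.2.2.1 k)))))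
  refine ((((hp z.2.2.2.1 w.2.2.2.1).sub (hn 0 z.2.2.2.1 w.2.2.2.1)).sub
    ((hp z.2.2.2.2 w.2.2.2.2).sub (hn N z.2.2.2.2 w.2.2.2.2))).add
    (HasDerivAt.fun_sum fun k _ => hk k)).congr_deriv ?_
  simp only [node_zero, zero_smul, zero_mul, add_zero]
  congr 1
  ring

end

section

variable {n N : ℕ}

theorem norm_le_of_fderiv_action_le {G : Esp n → ℝ} (hG : ContDiff ℝ 1 G) {ε : ℝ} (hε : 0 < ε)
    (hN : 0 < N) {C : ℝ} (hC : ∀ p, ‖fderiv ℝ G p‖ ≤ C) (z : PathSp n N)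
    (hz : ‖fderiv ℝ (action G ε (N : ℝ)⁻¹) z‖ ≤ 1) : ‖z‖ ≤ 5 + C := by
  have hC0 : 0 ≤ C := (norm_nonneg _).trans (hC 0)
  have hN' : (0 : ℝ) < N := Nat.cast_pos.2 hN
  have hτ : (N : ℝ)⁻¹ ≤ 1 := inv_le_one_of_one_le₀ (by exact_mod_cast hN)
  have hb (w : PathSp n N) : |fderiv ℝ (action G ε (N : ℝ)⁻¹) z w| ≤ ‖w‖ := by
    rw [← Real.norm_eq_abs]
    exact (ContinuousLinearMap.le_of_opNorm_le _ hz w).trans_eq (one_mul _)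
  have hGb (p v : Esp n) : |fderiv ℝ G p v| ≤ C * ‖v‖ :=
    ContinuousLinearMap.le_of_opNorm_le _ (hC p) v
  obtain ⟨x, d, ξ, η, η'⟩ := z
  have h1 := hb (0, 0, 0, 1, 0)
  have h2 := hb (0, 0, 0, 0, 1)
  have h3 (k : Fin N) := hb (0, 0, Pi.single k (d k), 0, 0)
  have h4 (k : Fin N) := hb (0, Pi.single k (ξ k), 0, 0, 0)
  simp only [fderiv_action hG hε, node_single, Prod.norm_mk, norm_zero, norm_one,
    max_eq_right zero_le_one, max_eq_left zero_le_one] at h1 h2 h3 h4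
  have hz0 (k : ℕ) : node k (0 : EuclideanSpace ℝ (Fin n)) (0 : Fin N → _) = 0 := by
    simp [node]
  have hG0 (p : Esp n) : fderiv ℝ G p (0, 0) = 0 := (fderiv ℝ G p).map_zero
  simp only [hz0, inner_zero_left, inner_zero_right, mul_zero, mul_one, zero_sub, sub_zero,
    add_zero, zero_add, Pi.zero_apply, hG0, Finset.sum_const_zero, abs_neg,
    Fin.is_lt, if_true] at h1 h2 h3 h4
  have hη := abs_le.1 h1
  have hη' := abs_le.1 h2
  have hσ := smoothNorm_pos hε x
  have hσ' := smoothNorm_pos hε (node N x d)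
  have hη2 : |η| ≤ 2 := abs_le_of_sq_le_sq (by
    linarith [sq_le_two_of_neg_one_le_prof (t := η) (by linarith)]) (by norm_num)
  have hη2' : |η'| ≤ 2 := abs_le_of_sq_le_sq (by
    linarith [sq_le_two_of_neg_one_le_prof (t := η') (by linarith)]) (by norm_num)
  have hx : ‖x‖ ≤ 2 := by
    linarith [norm_le_smoothNorm (ε := ε) x, prof_le_one η]
  have hd (k : Fin N) : ‖d k‖ ≤ 1 + C := by
    have h := h3 k
    rw [Finset.sum_eq_single k (fun i _ hi => by simp [hi, hG0]) (by simp)] at h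
    have hn : ‖(Pi.single k (d k) : Fin N → EuclideanSpace ℝ (Fin n))‖ ≤ ‖d k‖ :=
      (pi_norm_le_iff_of_nonneg (norm_nonneg _)).2 fun i => by
        rcases eq_or_ne i k with rfl | hi <;> simp [*]
    simp only [Pi.single_eq_same, real_inner_self_eq_norm_sq] at h
    have h5 := hGb (node k x d, ξ k) (0, d k)
    simp only [Prod.norm_mk, norm_zero, max_eq_right (norm_nonneg _)] at h5
    have h6 : (N : ℝ)⁻¹ * fderiv ℝ G (node k x d, ξ k) (0, d k) ≤ C * ‖d k‖ := by
      have := (le_abs_self _).trans h5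
      calc _ ≤ (N : ℝ)⁻¹ * (C * ‖d k‖) := by gcongr
        _ ≤ 1 * (C * ‖d k‖) := by gcongr
        _ = _ := one_mul _
    have h7 := (le_abs_self _).trans h
    have h8 : ‖d k‖ ^ 2 ≤ (1 + C) * ‖d k‖ := by
      simp only [max_self, max_eq_right (norm_nonneg _),
        max_eq_left (norm_nonneg _)] at h7
      nlinarith
    by_contra! h9
    have : 0 < ‖d k‖ := by linarith
    nlinarith
  have hξ (j : Fin N) : ‖ξ j‖ ≤ 3 + C := by
    have h := h4 j
    have hn : ‖(Pi.single j (ξ j) : Fin N → EuclideanSpace ℝ (Fin n))‖ ≤ ‖ξ j‖ :=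
      (pi_norm_le_iff_of_nonneg (norm_nonneg _)).2 fun i => by
        rcases eq_or_ne i j with rfl | hi <;> simp [*]
    rw [Finset.sum_sub_distrib, Finset.sum_eq_single j (fun i _ hi => by simp [hi]) (by simp)] at h
    simp only [Pi.single_eq_same, real_inner_self_eq_norm_sq] at h
    have h5 : |η' * ⟪(smoothNorm ε (node N x d))⁻¹ • node N x d, ξ j⟫| ≤ 2 * ‖ξ j‖ := by
      rw [abs_mul]
      have := (abs_real_inner_le_norm ((smoothNorm ε (node N x d))⁻¹ • node N x d) (ξ j)).trans
        (mul_le_mul_of_nonneg_right (norm_inv_smoothNorm_smul_le hε _) (norm_nonneg _))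
      calc _ ≤ 2 * (1 * ‖ξ j‖) := by gcongr
        _ = _ := by ring
    have h6 : ∑ k : Fin N, (N : ℝ)⁻¹ * fderiv ℝ G (node k x d, ξ k)
        (if (j : ℕ) < k then ξ j else 0, 0) ≤ C * ‖ξ j‖ := by
      calc _ ≤ ∑ k : Fin N, (N : ℝ)⁻¹ * (C * ‖ξ j‖) := by
            refine Finset.sum_le_sum fun k _ => ?_
            have h7 := hGb (node k x d, ξ k) (if (j : ℕ) < k then ξ j else 0, 0)
            have h8 : ‖(if (j : ℕ) < k then ξ j else 0)‖ ≤ ‖ξ j‖ := by split_ifs <;> simp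
            simp only [Prod.norm_mk, norm_zero, max_eq_left (norm_nonneg _)] at h7
            have := (le_abs_self _).trans h7
            gcongr
            exact this.trans (by gcongr)
        _ = C * ‖ξ j‖ := by
            rw [Finset.sum_const, Finset.card_univ, Fintype.card_fin, nsmul_eq_mul]
            field_simp
    have h7 := (le_abs_self _).trans h
    have h8 := neg_le_of_abs_le h5
    have h9 : ‖ξ j‖ ^ 2 ≤ (3 + C) * ‖ξ j‖ := by
      simp only [max_self, max_eq_right (norm_nonneg _),
        max_eq_left (norm_nonneg _)] at h7
      nlinarith
    by_contra! h10
    have : 0 < ‖ξ j‖ := by linarith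
    nlinarith
  simp only [Prod.norm_mk, Real.norm_eq_abs]
  refine max_le (by linarith) (max_le ?_ (max_le ?_ (max_le (by linarith) (by linarith))))
  · exact (pi_norm_le_iff_of_nonneg (by linarith)).2 fun i => (hd i).trans (by linarith)
  · exact (pi_norm_le_iff_of_nonneg (by linarith)).2 fun i => (hξ i).trans (by linarith)

theorem action_eq {G : Esp n → ℝ} {ε : ℝ} (hε : 0 < ε) (τ : ℝ) (z : PathSp n N) :
    action G ε τ z = primProf z.2.2.2.1 - primProf z.2.2.2.2
      - smoothNorm ε z.1 * (z.2.2.2.1 - z.2.2.2.2)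
      + ∑ k : Fin N, ⟪z.2.2.1 k + z.2.2.2.2 • (smoothNorm ε z.1 + smoothNorm ε
          (node N z.1 z.2.1))⁻¹ • (z.1 + node N z.1 z.2.1), z.2.1 k⟫
      - ∑ k : Fin N, τ * G (node k z.1 z.2.1, z.2.2.1 k) := by
  have h := smoothNorm_sub hε z.1 (node N z.1 z.2.1)
  have h2 : node N z.1 z.2.1 - z.1 = ∑ k, z.2.1 k := by simp [node_top]
  simp only [inner_add_left, real_inner_smul_left _ _ z.2.2.2.2, Finset.sum_add_distrib,
    ← Finset.mul_sum, ← inner_sum]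
  rw [← h2, ← h, action, Finset.sum_sub_distrib, node_zero, ← Finset.mul_sum]
  ring

theorem exists_fderiv_action_eq_zero {G : Esp n → ℝ} (hG : ContDiff ℝ 1 G) {ε : ℝ} (hε : 0 < ε)
    (hN : 0 < N) {C c : ℝ} (hC : ∀ p, ‖fderiv ℝ G p‖ ≤ C) (hG0 : ∀ p, 0 ≤ G p)
    (hGc : ∀ p, G p ≤ c) (hc : c + 2 * ε < Real.pi / 2) :
    ∃ z : PathSp n N, fderiv ℝ (action G ε (N : ℝ)⁻¹) z = 0 := by
  have hN' : (0 : ℝ) < N := Nat.cast_pos.2 hN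
  have hnode (k : ℕ) {α : Type} [TopologicalSpace α] {f : α → EuclideanSpace ℝ (Fin n)}
      {g : α → Fin N → EuclideanSpace ℝ (Fin n)} (hf : Continuous f) (hg : Continuous g) :
      Continuous fun a => node k (f a) (g a) :=
    (contDiff_node (n := n) (N := N) k).continuous.comp
      (g := fun z : PathSp n N => node k z.1 z.2.1)
      (f := fun a => (f a, g a, 0, 0, 0)) (by fun_prop)
  let S (x : EuclideanSpace ℝ (Fin n)) (d : Fin N → EuclideanSpace ℝ (Fin n)) :=
    (smoothNorm ε x + smoothNorm ε (node N x d))⁻¹ • (x + node N x d)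
  have hS {α : Type} [TopologicalSpace α] {f : α → EuclideanSpace ℝ (Fin n)}
      {g : α → Fin N → EuclideanSpace ℝ (Fin n)} (hf : Continuous f) (hg : Continuous g) :
      Continuous fun a => S (f a) (g a) := by
    have h1 := (contDiff_smoothNorm (n := n) hε).continuous
    exact (((h1.comp hf).add (h1.comp (hnode N hf hg))).inv₀ fun a =>
      (add_pos (smoothNorm_pos hε _) (smoothNorm_pos hε _)).ne').smul (hf.add (hnode N hf hg))
  let ι (q : EuclideanSpace ℝ (Fin n) × ℝ × ℝ × (Fin N → EuclideanSpace ℝ (Fin n))) :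
      PathSp n N :=
    (q.1, q.2.2.2, fun k => -q.2.2.2 k - q.2.2.1 • S q.1 q.2.2.2, q.2.1, q.2.2.1)
  let π (z : PathSp n N) :
      EuclideanSpace ℝ (Fin n) × ℝ × ℝ × (Fin N → EuclideanSpace ℝ (Fin n)) :=
    (z.1, z.2.2.2.1, z.2.2.2.2,
      fun k => (2⁻¹ : ℝ) • (z.2.1 k - z.2.2.1 k - z.2.2.2.2 • S z.1 z.2.1))
  have hAι (q) : action G ε (N : ℝ)⁻¹ (ι q) = primProf q.2.1 - primProf q.2.2.1
      - smoothNorm ε q.1 * (q.2.1 - q.2.2.1) - ∑ k, ‖q.2.2.2 k‖ ^ 2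
      - ∑ k : Fin N, (N : ℝ)⁻¹ * G (node k q.1 q.2.2.2, (ι q).2.2.1 k) := by
    rw [action_eq hε]
    simp [ι, S, ← sub_eq_add_neg]
  have hGs (q : PathSp n N) : 0 ≤ ∑ k : Fin N, (N : ℝ)⁻¹ * G (node k q.1 q.2.1, q.2.2.1 k) :=
    Finset.sum_nonneg fun k _ => mul_nonneg (by positivity) (hG0 _)
  refine exists_fderiv_eq_zero_of_linking (contDiff_action hG hε _) (R := 5 + C)
    (norm_le_of_fderiv_action_le hG hε hN hC) (ι := ι) (π := π)
    (U := fun q => q.2.1 - q.2.2.1) ?_ ?_ (by fun_prop) ?_ (r := 3) ?_ ?_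
    (p := (0, 1, -1, 0)) (by norm_num) (b := Real.pi / 2 - 2 * ε - c) (by linarith) ?_
  · have := hS (f := fun q : EuclideanSpace ℝ (Fin n) × ℝ × ℝ ×
      (Fin N → EuclideanSpace ℝ (Fin n)) => q.1) (g := fun q => q.2.2.2)
      (by fun_prop) (by fun_prop)
    fun_prop
  · have := hS (f := fun z : PathSp n N => z.1) (g := fun z => z.2.1)
      (by fun_prop) (by fun_prop)
    fun_prop
  · intro q
    refine Prod.ext rfl (Prod.ext rfl (Prod.ext rfl (funext fun k => ?_)))
    simp only [π, ι]
    module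
  · intro q hq
    have hq' : q.2.1 = q.2.2.1 := sub_eq_zero.1 hq
    have h1 := hGs (ι q)
    have h2 : 0 ≤ ∑ k, ‖q.2.2.2 k‖ ^ 2 := by positivity
    rw [hAι, hq']
    simp only [ι] at h1 ⊢
    linarith
  · intro q hq hA
    have hq' : q.2.2.1 ≤ q.2.1 := sub_nonneg.1 hq
    have h1 := hGs (ι q)
    rw [hAι] at hA
    have h2 : 0 ≤ ∑ k, ‖q.2.2.2 k‖ ^ 2 := by positivity
    have h3 : ∑ k, ‖q.2.2.2 k‖ ^ 2 < primProf q.2.1 - primProf q.2.2.1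
      - smoothNorm ε q.1 * (q.2.1 - q.2.2.1) := by
      simp only [ι] at h1 hA
      linarith
    have h4 := primProf_sub_le hq'
    have h5 := primProf_sub_le_cubic hq'
    have hσ := smoothNorm_pos hε q.1
    have hlt : 0 < q.2.1 - q.2.2.1 := by
      rcases hq'.eq_or_lt with h | h
      · rw [h] at h3
        linarith
      · linarith
    have h6 : smoothNorm ε q.1 < 1 := by
      by_contra! h
      nlinarith
    have h7 : q.2.2.1 ^ 2 + q.2.2.1 * q.2.1 + q.2.1 ^ 2 < 6 := by
      by_contra! h
      nlinarith
    have h8 : |q.2.1| ≤ 3 :=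
      abs_le_of_sq_le_sq (by nlinarith [sq_nonneg (q.2.1 + 2 * q.2.2.1)]) (by norm_num)
    have h9 : |q.2.2.1| ≤ 3 :=
      abs_le_of_sq_le_sq (by nlinarith [sq_nonneg (2 * q.2.1 + q.2.2.1)]) (by norm_num)
    have h10 (k : Fin N) : ‖q.2.2.2 k‖ ≤ 3 := by
      have h11 := Finset.single_le_sum (f := fun k => ‖q.2.2.2 k‖ ^ 2)
        (fun i _ => sq_nonneg _) (Finset.mem_univ k)
      have := abs_le.1 h8
      have := abs_le.1 h9
      have h12 : ‖q.2.2.2 k‖ ^ 2 ≤ 3 ^ 2 := by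
        have : 0 ≤ smoothNorm ε q.1 * (q.2.1 - q.2.2.1) := by positivity
        linarith
      exact le_of_sq_le_sq h12 (by norm_num)
    refine max_le ?_ (max_le h8 (max_le h9 ?_))
    · exact (norm_le_smoothNorm (ε := ε) _).trans (by linarith)
    · exact (pi_norm_le_iff_of_nonneg (by norm_num)).2 h10
  · intro z hz
    obtain ⟨x, d, ξ, η, η'⟩ := z
    simp only [π, Prod.mk.injEq] at hz
    obtain ⟨rfl, rfl, rfl, hz⟩ := hz
    have h1 (k : Fin N) : ξ k + (-1 : ℝ) • S 0 d = d k := by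
      have h2 := congrFun hz k
      simp only [Pi.zero_apply, smul_eq_zero, inv_eq_zero, OfNat.ofNat_ne_zero, false_or] at h2
      generalize S 0 d = s at h2 ⊢
      rw [← sub_eq_zero, show ξ k + (-1 : ℝ) • s - d k = -(d k - ξ k - (-1 : ℝ) • s) by module,
        h2, neg_zero]
    rw [action_eq hε]
    simp only [S] at h1
    simp only [h1, real_inner_self_eq_norm_sq]
    have h2 : smoothNorm ε (0 : EuclideanSpace ℝ (Fin n)) = ε := by
      simp [smoothNorm, Real.sqrt_sq hε.le]
    have h3 : 0 ≤ ∑ k, ‖d k‖ ^ 2 := by positivity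
    have h4 : ∑ k : Fin N, (N : ℝ)⁻¹ * G (node k 0 d, ξ k) ≤ c := by
      calc _ ≤ ∑ k : Fin N, (N : ℝ)⁻¹ * c := by gcongr; exact hGc _
        _ = c := by
          rw [Finset.sum_const, Finset.card_univ, Fintype.card_fin, nsmul_eq_mul]
          field_simp
    rw [h2, primProf_one_sub]
    linarith

/-- The smoothing of the boundary of the saucer. -/
def smoothSaucer (n : ℕ) (ε : ℝ) : Set (Esp n) :=
  {p | ∃ η : ℝ, ‖p.1‖ ^ 2 + ε ^ 2 + η ^ 2 = 1 ∧ p.2 = -(η • (smoothNorm ε p.1)⁻¹ • p.1)}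

/-- A bounded Hamiltonian has a discrete trajectory with both ends on the smoothed saucer. -/
theorem exists_discrete_trajectory {G : Esp n → ℝ} (hG : ContDiff ℝ 1 G) {ε : ℝ} (hε : 0 < ε)
    (hN : 0 < N) {C c : ℝ} (hC : ∀ p, ‖fderiv ℝ G p‖ ≤ C) (hG0 : ∀ p, 0 ≤ G p)
    (hGc : ∀ p, G p ≤ c) (hc : c + 2 * ε < Real.pi / 2) :
    ∃ z : ℕ → Esp n, z 0 ∈ smoothSaucer n ε ∧ z N ∈ smoothSaucer n ε ∧
      ∀ k < N, z (k + 1) = z k + (N : ℝ)⁻¹ • hamVF G ((z k).1, (z (k + 1)).2) := by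
  obtain ⟨⟨x, d, ξ, η, η'⟩, hz⟩ :=
    exists_fderiv_action_eq_zero (N := N) hG hε hN hC hG0 hGc hc
  set τ := (N : ℝ)⁻¹
  have hGd : Differentiable ℝ G := hG.differentiable (by norm_num)
  have hdG0 (p : Esp n) : fderiv ℝ G p (0, 0) = 0 := (fderiv ℝ G p).map_zero
  have hb (w : PathSp n N) : fderiv ℝ (action G ε τ) (x, d, ξ, η, η') w = 0 := by
    rw [hz]
    rfl
  have h0 (v : EuclideanSpace ℝ (Fin n)) := hb (v, 0, 0, 0, 0)
  have h1 := hb (0, 0, 0, 1, 0)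
  have h2 := hb (0, 0, 0, 0, 1)
  have h3 (k : Fin N) (v : EuclideanSpace ℝ (Fin n)) := hb (0, 0, Pi.single k v, 0, 0)
  have h4 (k : Fin N) (v : EuclideanSpace ℝ (Fin n)) := hb (0, Pi.single k v, 0, 0, 0)
  have hz1 (k : ℕ) (v : EuclideanSpace ℝ (Fin n)) : node k v (0 : Fin N → _) = v := by
    simp [node]
  simp only [fderiv_action hG hε, node_single] at h0 h1 h2 h3 h4
  simp only [hz1, inner_zero_left, inner_zero_right, mul_zero, mul_one, zero_sub, sub_zero,
    add_zero, zero_add, Pi.zero_apply, hdG0, Finset.sum_const_zero,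
    Fin.is_lt, if_true] at h0 h1 h2 h3 h4
  have e1 := sq_add_sq_eq_one_of_prof_eq (smoothNorm_pos hε x) (sub_eq_zero.1 h1)
  have e2 := sq_add_sq_eq_one_of_prof_eq (smoothNorm_pos hε (node N x d))
    (sub_eq_zero.1 (neg_eq_zero.1 h2))
  rw [smoothNorm_sq] at e1 e2
  let q (k : Fin N) := hamVF G (node k x d, ξ k)
  let s := (smoothNorm ε (node N x d))⁻¹ • node N x d
  have hd (k : Fin N) : d k = τ • (q k).1 := by
    refine ext_inner_right ℝ fun v => ?_
    have h := h3 k v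
    rw [Finset.sum_eq_single k (fun i _ hi => by simp [hi, hdG0]) (by simp)] at h
    rw [real_inner_smul_left, inner_hamVF_fst (hGd _)]
    simp only [Pi.single_eq_same] at h
    rw [real_inner_comm]
    linarith
  let Ξ (j : ℕ) := -(η' • s) - ∑ k : Fin N, if j ≤ k then τ • (q k).2 else 0
  have hΞs (j : Fin N) : Ξ (j + 1) = ξ j := by
    refine ext_inner_right ℝ fun v => ?_
    have h := h4 j v
    rw [Finset.sum_sub_distrib, Finset.sum_eq_single j (fun i _ hi => by simp [hi]) (by simp)] at h
    simp only [Pi.single_eq_same] at h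
    simp only [Ξ, inner_sub_left, inner_neg_left, sum_inner, real_inner_smul_left]
    have h5 : ∑ k : Fin N, ⟪(if (j : ℕ) + 1 ≤ k then τ • (q k).2 else 0), v⟫
        = -∑ k : Fin N, τ * fderiv ℝ G (node k x d, ξ k) (if (j : ℕ) < k then v else 0, 0) := by
      rw [← Finset.sum_neg_distrib]
      refine Finset.sum_congr rfl fun k _ => ?_
      simp only [Nat.succ_le_iff]
      split_ifs
      · rw [real_inner_smul_left, inner_hamVF_snd (hGd _)]
        ring
      · simp [hdG0]
    rw [h5]
    linarith
  have hΞ0 : Ξ 0 = -(η • (smoothNorm ε x)⁻¹ • x) := by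
    refine ext_inner_right ℝ fun v => ?_
    have h := h0 v
    simp only [Ξ, inner_sub_left, inner_neg_left, sum_inner, zero_le, if_true]
    have h5 : ∑ k : Fin N, ⟪τ • (q k).2, v⟫
        = -∑ k : Fin N, τ * fderiv ℝ G (node k x d, ξ k) (v, 0) := by
      rw [← Finset.sum_neg_distrib]
      refine Finset.sum_congr rfl fun k _ => ?_
      rw [real_inner_smul_left, inner_hamVF_snd (hGd _)]
      ring
    rw [h5, real_inner_smul_left, real_inner_smul_left _ _ η]
    rw [Finset.sum_neg_distrib] at h
    linarith
  have hΞN : Ξ N = -(η' • s) := by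
    simp [Ξ, fun k : Fin N => not_le.2 k.is_lt]
  have hΞ (j : Fin N) : Ξ (j + 1) = Ξ j + τ • (q j).2 := by
    have h5 : ∑ k : Fin N, (if (j : ℕ) ≤ k then τ • (q k).2 else 0)
        = ∑ k : Fin N, (if (j : ℕ) + 1 ≤ k then τ • (q k).2 else 0) + τ • (q j).2 := by
      rw [← Finset.sum_erase_add _ _ (Finset.mem_univ j),
        ← Finset.sum_erase_add Finset.univ
          (fun k : Fin N => if (j : ℕ) + 1 ≤ k then τ • (q k).2 else 0) (Finset.mem_univ j)]
      simp only [le_refl, if_true, Nat.not_succ_le_self, if_false, add_zero, add_left_inj]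
      refine Finset.sum_congr rfl fun k hk => ?_
      have : (k : ℕ) ≠ j := fun h => Finset.ne_of_mem_erase hk (Fin.ext h)
      simp only [show (j : ℕ) + 1 ≤ k ↔ (j : ℕ) ≤ k by omega]
    simp only [Ξ, h5]
    abel
  refine ⟨fun k => (node k x d, Ξ k), ⟨η, ?_, ?_⟩, ⟨η', e2, hΞN⟩, fun k hk => ?_⟩
  · simpa [node_zero] using e1
  · simpa [node_zero] using hΞ0
  · have h6 := hΞs ⟨k, hk⟩
    have h7 := hΞ ⟨k, hk⟩
    have h8 := node_succ ⟨k, hk⟩ x d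
    have h9 := hd ⟨k, hk⟩
    simp only at h6 h7 h8 h9
    refine Prod.ext ?_ ?_
    · simp only [Prod.fst_add, Prod.smul_fst, h8, h9, h6, q]
    · simp only [Prod.snd_add, Prod.smul_snd]
      rw [h6] at h7 ⊢
      exact h7

end

section

variable {n : ℕ}

theorem isCompact_saucer : IsCompact (saucer n) := by
  refine IsCompact.of_isClosed_subset (isCompact_closedBall (0 : Esp n) 1) ?_ ?_
  · refine IsClosed.union (IsClosed.inter ?_ ?_) (IsClosed.inter ?_ ?_)
    · exact isClosed_eq (by fun_prop) continuous_const
    · refine isClosed_compl_iff.2 ((isOpen_setOfPred_linearIndependent (𝕜 := ℝ) (ι := Fin 2)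
        (E := EuclideanSpace ℝ (Fin n))).preimage (f := fun p : Esp n => ![p.1, p.2]) ?_)
      exact continuous_pi fun i => by fin_cases i <;> simp <;> fun_prop
    · exact isClosed_eq continuous_fst continuous_const
    · exact isClosed_le continuous_snd.norm continuous_const
  · rintro p (⟨h, -⟩ | ⟨h1, h2⟩)
    · rw [mem_closedBall_zero_iff]
      exact max_le (by nlinarith [sq_nonneg ‖p.2‖, norm_nonneg p.1])
        (by nlinarith [sq_nonneg ‖p.1‖, norm_nonneg p.2])
    · rw [mem_closedBall_zero_iff]
      exact max_le (by simp [h1]) h2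

theorem exists_smoothSaucer_subset {U : Set (Esp n)} (hU : IsOpen U) (hs : saucer n ⊆ U) :
    ∃ ε₀ > 0, ∀ ε, 0 < ε → ε < ε₀ → smoothSaucer n ε ⊆ U := by
  obtain ⟨δ, hδ, hδU⟩ := isCompact_saucer.exists_thickening_subset_open hU hs
  refine ⟨min δ (δ ^ 2 / 2), by positivity, fun ε hε hε₀ => ?_⟩
  rintro ⟨x, ξ⟩ ⟨η, h1, h2⟩
  simp only at h1 h2
  have hσ := smoothNorm_pos hε x
  have hσx := norm_le_smoothNorm (ε := ε) x
  have hσ2 := smoothNorm_sq (ε := ε) x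
  have hη : |η| ≤ 1 := abs_le_of_sq_le_sq (by nlinarith [sq_nonneg ε, sq_nonneg ‖x‖]) zero_le_one
  refine hδU (Metric.mem_thickening_iff.2 ?_)
  rcases lt_or_ge ‖x‖ (δ / 2) with hx | hx
  · refine ⟨(0, ξ), Or.inr ⟨rfl, ?_⟩, ?_⟩
    · rw [h2, norm_neg, norm_smul, Real.norm_eq_abs]
      exact mul_le_one₀ hη (norm_nonneg _) (norm_inv_smoothNorm_smul_le hε x)
    · rw [dist_eq_norm]
      simpa [Prod.norm_mk, hδ] using hx.trans (half_lt_self hδ)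
  · have hx0 : 0 < ‖x‖ := by linarith
    have hd : smoothNorm ε x - ‖x‖ ≤ ε := by nlinarith
    refine ⟨((smoothNorm ε x * ‖x‖⁻¹) • x, -((η * ‖x‖⁻¹) • x)), Or.inl ⟨?_, fun h => ?_⟩, ?_⟩
    · simp only [norm_neg, norm_smul, norm_mul, norm_inv, Real.norm_eq_abs, mul_pow,
        sq_abs, inv_pow]
      rw [hσ2]
      field_simp
      linarith
    · have := (LinearIndependent.pair_iff.1 h η (smoothNorm ε x) (by module)).2
      exact hσ.ne' this
    · rw [dist_eq_norm, h2, Prod.mk_sub_mk]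
      refine max_lt ?_ ?_
      · rw [← norm_neg, show -(x - (smoothNorm ε x * ‖x‖⁻¹) • x)
          = (smoothNorm ε x * ‖x‖⁻¹ - 1) • x by module, norm_smul, Real.norm_eq_abs,
          ← abs_norm x, ← abs_mul, sub_mul, abs_norm, inv_mul_cancel_right₀ hx0.ne', one_mul,
          abs_of_nonneg (by linarith)]
        exact hd.trans_lt (hε₀.trans_le (min_le_left _ _))
      · rw [show -(η • (smoothNorm ε x)⁻¹ • x) - -((η * ‖x‖⁻¹) • x)
          = η • (‖x‖⁻¹ - (smoothNorm ε x)⁻¹) • x by module, norm_smul, norm_smul,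
          Real.norm_eq_abs, Real.norm_eq_abs, ← abs_norm x, ← abs_mul (_ - _), sub_mul, abs_norm,
          inv_mul_cancel₀ hx0.ne']
        have h3 : 1 - (smoothNorm ε x)⁻¹ * ‖x‖ = (smoothNorm ε x - ‖x‖) / smoothNorm ε x := by
          field_simp
        have h4 : (smoothNorm ε x - ‖x‖) / smoothNorm ε x < δ := by
          rw [div_lt_iff₀ hσ]
          have := hε₀.trans_le (min_le_right _ _)
          nlinarith
        have h5 : 0 ≤ (smoothNorm ε x - ‖x‖) / smoothNorm ε x :=
          div_nonneg (by linarith) hσ.le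
        rw [h3, abs_of_nonneg h5]
        exact (mul_le_of_le_one_left h5 hη).trans_lt h4

/-- The standard symplectic form. -/
def sympForm (u v : Esp n) : ℝ := ⟪u.1, v.2⟫ - ⟪u.2, v.1⟫

theorem sympForm_sub_left (u u' v : Esp n) :
    sympForm (u - u') v = sympForm u v - sympForm u' v := by
  simp only [sympForm, Prod.fst_sub, Prod.snd_sub, inner_sub_left]
  ring

theorem eq_zero_of_sympForm {u : Esp n} (h : ∀ v, sympForm u v = 0) : u = 0 := by
  have h1 := h (0, u.1)
  have h2 := h (u.2, 0)
  simp only [sympForm, inner_zero_right, sub_zero, zero_sub, neg_eq_zero, inner_self_eq_zero]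
    at h1 h2
  exact Prod.ext h1 h2

/-- The Hamiltonian vector associated with a covector. -/
def hamLin (n : ℕ) : (Esp n →L[ℝ] ℝ) →L[ℝ] Esp n :=
  LinearMap.toContinuousLinearMap
    { toFun := fun l => ((InnerProductSpace.toDual ℝ _).symm (l.comp (.inr ℝ _ _)),
        -(InnerProductSpace.toDual ℝ _).symm (l.comp (.inl ℝ _ _)))
      map_add' := fun l m => by
        simp only [ContinuousLinearMap.add_comp, map_add, neg_add, Prod.mk_add_mk]
      map_smul' := fun c l => by
        simp only [ContinuousLinearMap.smul_comp, map_smulₛₗ, conj_trivial, RingHom.id_apply,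
          Prod.smul_mk, smul_neg] }

theorem hamVF_eq_hamLin {f : Esp n → ℝ} {p : Esp n} (hf : DifferentiableAt ℝ f p) :
    hamVF f p = hamLin n (fderiv ℝ f p) := by
  have h1 : HasFDerivAt (fun η => f (p.1, η)) ((fderiv ℝ f p).comp (.inr ℝ _ _)) p.2 :=
    HasFDerivAt.comp (f := fun η => (p.1, η)) p.2 hf.hasFDerivAt (hasFDerivAt_prodMk_right _ _)
  have h2 : HasFDerivAt (fun y => f (y, p.2)) ((fderiv ℝ f p).comp (.inl ℝ _ _)) p.1 :=
    HasFDerivAt.comp (f := fun y => (y, p.2)) p.1 hf.hasFDerivAt (hasFDerivAt_prodMk_left _ _)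
  simp [hamVF, gradient, h1.fderiv, h2.fderiv, hamLin]

theorem sympForm_hamLin (l : Esp n →L[ℝ] ℝ) (v : Esp n) : sympForm (hamLin n l) v = l v := by
  have : v = (0, v.2) + (v.1, 0) := by simp
  conv_rhs => rw [this, map_add]
  simp [sympForm, hamLin]

/-- A `C¹` symplectic map that is the identity near infinity. -/
structure IsSymplecticCompact (φ : Esp n → Esp n) : Prop where
  contDiff : ContDiff ℝ 1 φ
  sympForm_fderiv : ∀ z u v, sympForm (fderiv ℝ φ z u) (fderiv ℝ φ z v) = sympForm u v
  eq_self : ∃ R : ℝ, ∀ z, R < ‖z‖ → φ z = z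

theorem IsSymplecticCompact.id : IsSymplecticCompact (fun z : Esp n => z) :=
  ⟨contDiff_id, fun z u v => by simp, 0, fun _ _ => rfl⟩

theorem IsSymplecticCompact.comp {φ ψ : Esp n → Esp n} (hφ : IsSymplecticCompact φ)
    (hψ : IsSymplecticCompact ψ) : IsSymplecticCompact (fun z => φ (ψ z)) := by
  refine ⟨hφ.contDiff.comp hψ.contDiff, fun z u v => ?_, ?_⟩
  · have := fderiv_comp (𝕜 := ℝ) z (hφ.contDiff.differentiable (by norm_num) (ψ z))
      (hψ.contDiff.differentiable (by norm_num) z)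
    rw [show (fun z => φ (ψ z)) = φ ∘ ψ from rfl, this]
    simp only [ContinuousLinearMap.comp_apply, hφ.sympForm_fderiv, hψ.sympForm_fderiv]
  · obtain ⟨R, hR⟩ := hφ.eq_self
    obtain ⟨R', hR'⟩ := hψ.eq_self
    refine ⟨max R R', fun z hz => ?_⟩
    simp only [hR' z ((le_max_right _ _).trans_lt hz), hR z ((le_max_left _ _).trans_lt hz)]

theorem IsSymplecticCompact.fderiv_hamVF {φ : Esp n → Esp n} (hφ : IsSymplecticCompact φ)
    {K : Esp n → ℝ} (hK : Differentiable ℝ K) (z : Esp n) :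
    fderiv ℝ φ z (hamVF (fun y => K (φ y)) z) = hamVF K (φ z) := by
  have hφd := hφ.contDiff.differentiable (by norm_num)
  have hinj : Function.Injective (fderiv ℝ φ z) := by
    refine (injective_iff_map_eq_zero _).2 fun u hu => eq_zero_of_sympForm fun v => ?_
    rw [← hφ.sympForm_fderiv z, hu]
    simp [sympForm]
  have hsurj : Function.Surjective (fderiv ℝ φ z) :=
    (LinearMap.injective_iff_surjective (f := (fderiv ℝ φ z : Esp n →ₗ[ℝ] Esp n))).1 hinj
  have hd : fderiv ℝ (fun y => K (φ y)) z = (fderiv ℝ K (φ z)).comp (fderiv ℝ φ z) :=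
    fderiv_comp (𝕜 := ℝ) z (hK (φ z)) (hφd z)
  rw [← sub_eq_zero]
  refine eq_zero_of_sympForm fun v => ?_
  obtain ⟨v, rfl⟩ := hsurj v
  rw [sympForm_sub_left, hφ.sympForm_fderiv, hamVF_eq_hamLin (show DifferentiableAt ℝ (fun y => K (φ y)) z from hK.comp hφd z),
    hamVF_eq_hamLin (hK _), sympForm_hamLin, sympForm_hamLin, hd]
  simp

/-- One step of the symplectic Euler scheme. -/
theorem exists_symplectic_euler {f : Esp n → ℝ} (hf : ContDiff ℝ 2 f) {L : NNReal}
    (hL : LipschitzWith L (hamVF f)) {C : ℝ} (hC : ∀ z, ‖hamVF f z‖ ≤ C) {R : ℝ}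
    (hR : ∀ z, R < ‖z‖ → hamVF f z = 0) {τ : ℝ} (hτ : 0 ≤ τ) (hτL : τ * L < 1) :
    ∃ ψ : Esp n → Esp n, IsSymplecticCompact ψ ∧
      ∀ z, ‖ψ z - z - τ • hamVF f z‖ ≤ τ * (L * (τ * C)) := by
  have hfd : Differentiable ℝ f := hf.differentiable (by norm_num)
  have hfd2 : ContDiff ℝ 1 (fderiv ℝ f) := hf.fderiv_right (by norm_num)
  have hX : hamVF f = fun z => hamLin n (fderiv ℝ f z) :=
    funext fun z => hamVF_eq_hamLin (hfd z)
  have hXc : ContDiff ℝ 1 (hamVF f) := by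
    rw [hX]
    exact (hamLin n).contDiff.comp hfd2
  have hXd : Differentiable ℝ (hamVF f) := hXc.differentiable (by norm_num)
  have hXsymm (z u v : Esp n) : sympForm (fderiv ℝ (hamVF f) z u) v
      = sympForm (fderiv ℝ (hamVF f) z v) u := by
    have h1 : fderiv ℝ (hamVF f) z = (hamLin n).comp (fderiv ℝ (fderiv ℝ f) z) := by
      rw [hX]
      exact ((hamLin n).hasFDerivAt.comp z
        (hfd2.differentiable (by norm_num) z).hasFDerivAt).fderiv
    simp only [h1, ContinuousLinearMap.comp_apply, sympForm_hamLin]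
    exact (hf.contDiffAt.isSymmSndFDerivAt (by simp)) u v
  let P : Esp n →L[ℝ] Esp n := -(τ • (ContinuousLinearMap.inr ℝ _ _).comp (.snd ℝ _ _))
  have hP (u : Esp n) : P u = (0, -(τ • u.2)) := by simp [P]
  have hPn (u : Esp n) : ‖P u‖ ≤ τ * ‖u‖ := by
    rw [hP, Prod.norm_mk, norm_zero, norm_neg, norm_smul, Real.norm_of_nonneg hτ]
    exact max_le (by positivity) (by gcongr; exact norm_snd_le u)
  have hPL : LipschitzWith (τ.toNNReal * L) fun z => P (hamVF f z) := by
    refine LipschitzWith.of_dist_le_mul fun z w => ?_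
    rw [dist_eq_norm, ← map_sub, NNReal.coe_mul, Real.coe_toNNReal _ hτ, mul_assoc]
    refine (hPn _).trans ?_
    gcongr
    rw [← dist_eq_norm]
    exact hL.dist_le_mul z w
  obtain ⟨α, hα⟩ := exists_homeomorph_id_add hPL (by
    rw [← NNReal.coe_lt_coe, NNReal.coe_mul, Real.coe_toNNReal _ hτ]
    exact hτL)
  have hαf : (α : Esp n → Esp n) = fun z => z + P (hamVF f z) := funext hα
  have hαd (z : Esp n) : HasFDerivAt α (.id ℝ _ + P.comp (fderiv ℝ (hamVF f) z)) z := by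
    rw [hαf]
    exact (hasFDerivAt_id z).add (P.hasFDerivAt.comp z (hXd z).hasFDerivAt)
  have hαc : ContDiff ℝ 1 α := by
    rw [hαf]
    exact contDiff_id.add (P.contDiff.comp hXc)
  have hPd (z : Esp n) : ‖P.comp (fderiv ℝ (hamVF f) z)‖ < 1 := by
    have h1 := (P.hasFDerivAt.comp z (hXd z).hasFDerivAt).le_of_lipschitz hPL
    refine h1.trans_lt ?_
    rw [NNReal.coe_mul, Real.coe_toNNReal _ hτ]
    exact hτL
  let αe (z : Esp n) : Esp n ≃L[ℝ] Esp n := ContinuousLinearEquiv.ofUnit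
    (Units.oneSub (-P.comp (fderiv ℝ (hamVF f) z)) (by rw [norm_neg]; exact hPd z))
  have hαe (z : Esp n) : (αe z : Esp n →L[ℝ] Esp n) = .id ℝ _ + P.comp (fderiv ℝ (hamVF f) z) := by
    refine ContinuousLinearMap.ext fun u => ?_
    change (1 - -P.comp (fderiv ℝ (hamVF f) z)) u = _
    simp
  have hsymm : ContDiff ℝ 1 α.symm := α.contDiff_symm (f₀' := αe)
    (fun z => by rw [hαe]; exact hαd z) hαc
  have hβ (z : Esp n) : HasFDerivAt (fun z => α z + τ • hamVF f z)
      ((αe z : Esp n →L[ℝ] Esp n) + τ • fderiv ℝ (hamVF f) z) z := by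
    rw [hαe]
    exact (hαd z).add ((hXd z).hasFDerivAt.const_smul τ)
  have hψc : ContDiff ℝ 1 fun z => z + τ • hamVF f (α.symm z) :=
    contDiff_id.add ((hXc.comp hsymm).const_smul τ)
  refine ⟨fun z => z + τ • hamVF f (α.symm z), ⟨hψc, fun z u v => ?_, R, fun z hz => ?_⟩,
    fun z => ?_⟩
  · obtain ⟨z, rfl⟩ := α.surjective z
    obtain ⟨u, rfl⟩ := (αe z).surjective u
    obtain ⟨v, rfl⟩ := (αe z).surjective v
    have h1 : (fderiv ℝ (fun z => z + τ • hamVF f (α.symm z)) (α z)).comp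
        (αe z : Esp n →L[ℝ] Esp n) = (αe z : Esp n →L[ℝ] Esp n) + τ • fderiv ℝ (hamVF f) z := by
      refine HasFDerivAt.unique ?_ (hβ z)
      have h2 := (hψc.differentiable (by norm_num) (α z)).hasFDerivAt.comp z
        (show HasFDerivAt α (αe z : Esp n →L[ℝ] Esp n) z by rw [hαe]; exact hαd z)
      refine h2.congr_of_eventuallyEq (Filter.Eventually.of_forall fun y => ?_)
      simp
    have h3 (u : Esp n) : fderiv ℝ (fun z => z + τ • hamVF f (α.symm z)) (α z) (αe z u)
        = αe z u + τ • fderiv ℝ (hamVF f) z u := DFunLike.congr_fun h1 u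
    have h4 (u : Esp n) : αe z u = u + P (fderiv ℝ (hamVF f) z u) := DFunLike.congr_fun (hαe z) u
    have h5 := hXsymm z u v
    rw [h3 u, h3 v]
    simp only [h4, hP, sympForm, Prod.fst_add, Prod.snd_add, Prod.smul_fst, Prod.smul_snd,
      inner_add_left, inner_add_right, inner_neg_left, inner_neg_right, real_inner_smul_left,
      real_inner_smul_right, add_zero] at h5 ⊢
    rw [real_inner_comm u.2, real_inner_comm u.1] at h5
    linear_combination τ * h5
  · have h1 : α z = z := by simp [hα, hR z hz]
    have h2 : α.symm z = z := by rw [Homeomorph.symm_apply_eq, h1]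
    simp [h2, hR z hz]
  · obtain ⟨z, rfl⟩ := α.surjective z
    rw [add_sub_cancel_left, Homeomorph.symm_apply_apply, ← smul_sub, norm_smul,
      Real.norm_of_nonneg hτ, ← dist_eq_norm]
    gcongr
    refine (hL.dist_le_mul _ _).trans ?_
    gcongr
    rw [hα, dist_self_add_right]
    exact (hPn _).trans (by gcongr; exact hC z)

/-- Symplectic Euler approximation of the time-one map of a compactly supported Hamiltonian. -/
theorem exists_symplectic_approx_of_lipschitz {f : ℝ → Esp n → ℝ} (hf : ∀ s, ContDiff ℝ 2 (f s))
    {L : NNReal} (hL : LipschitzWith L fun z : Esp n × ℝ => hamVF (f z.2) z.1) {C : ℝ}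
    (hC1 : 1 ≤ C) (hC : ∀ s z, ‖hamVF (f s) z‖ ≤ C) {R : ℝ}
    (hR : ∀ s z, R < ‖z‖ → hamVF (f s) z = 0) {S : Set (Esp n)} {Φ : Esp n → ℝ → Esp n}
    (hΦ0 : ∀ p ∈ S, Φ p 0 = p)
    (hΦ : ∀ p ∈ S, ∀ s ∈ Set.Icc (0 : ℝ) 1, HasDerivAt (Φ p) (hamVF (f s) (Φ p s)) s)
    {δ : ℝ} (hδ : 0 < δ) :
    ∃ φ : Esp n → Esp n, IsSymplecticCompact φ ∧ ∀ p ∈ S, ‖φ p - Φ p 1‖ ≤ δ := by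
  have hLs (s : ℝ) : LipschitzWith L (hamVF (f s)) := by
    have := hL.comp (LipschitzWith.prodMk_right s)
    rwa [mul_one] at this
  have hstep (p) (hp : p ∈ S) (s t : ℝ) (hs : 0 ≤ s) (hst : s ≤ t) (ht : t ≤ 1) :
      ‖Φ p t - Φ p s - (t - s) • hamVF (f s) (Φ p s)‖ ≤ (t - s) * (L * ((t - s) * C)) := by
    have h1 (u) (hu : u ∈ Set.Icc s t) : ‖Φ p u - Φ p s‖ ≤ C * (u - s) :=
      norm_image_sub_le_of_norm_deriv_le_segment'
        (fun u hu => (hΦ p hp u ⟨hs.trans hu.1, hu.2.trans ht⟩).hasDerivWithinAt)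
        (fun u _ => hC u _) u hu
    have h2 := norm_image_sub_le_of_norm_deriv_le_segment' (a := s) (b := t)
      (f := fun u => Φ p u - u • hamVF (f s) (Φ p s))
      (f' := fun u => hamVF (f u) (Φ p u) - (1 : ℝ) • hamVF (f s) (Φ p s))
      (C := L * ((t - s) * C))
      (fun u hu => ((hΦ p hp u ⟨hs.trans hu.1, hu.2.trans ht⟩).sub
        ((hasDerivAt_id u).smul_const _)).hasDerivWithinAt) ?_ t ⟨hst, le_rfl⟩
    · rw [mul_comm (t - s)]
      rwa [show Φ p t - t • hamVF (f s) (Φ p s) - (Φ p s - s • hamVF (f s) (Φ p s))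
        = Φ p t - Φ p s - (t - s) • hamVF (f s) (Φ p s) by module] at h2
    · intro u hu
      rw [one_smul, ← dist_eq_norm]
      refine (hL.dist_le_mul (Φ p u, u) (Φ p s, s)).trans ?_
      gcongr
      rw [Prod.dist_eq, dist_eq_norm, Real.dist_eq, abs_of_nonneg (sub_nonneg.2 hu.1)]
      have h3 : u - s ≤ t - s := by linarith [hu.2]
      have h4 : 0 ≤ u - s := sub_nonneg.2 hu.1
      refine max_le ((h1 u ⟨hu.1, hu.2.le⟩).trans ?_) ?_
      · rw [mul_comm]
        gcongr
      · nlinarith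
  obtain ⟨M, hM⟩ := exists_nat_gt (max (L : ℝ) (Real.exp L * (2 * (L * C)) / δ))
  have hM0 : (0 : ℝ) < M := (NNReal.coe_nonneg L).trans_lt ((le_max_left _ _).trans_lt hM)
  set τ : ℝ := (M : ℝ)⁻¹ with hτ
  have hτ0 : 0 < τ := inv_pos.2 hM0
  have hτL : τ * L < 1 := by
    rw [hτ, inv_mul_lt_iff₀ hM0, mul_one]
    exact (le_max_left _ _).trans_lt hM
  have hMτ : M * τ = 1 := mul_inv_cancel₀ hM0.ne'
  have key : ∀ j : ℕ, j ≤ M → ∃ φ : Esp n → Esp n, IsSymplecticCompact φ ∧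
      ∀ p ∈ S, ‖φ p - Φ p (j * τ)‖ ≤ (1 + τ * L) ^ j * (j * (2 * (τ * (L * (τ * C))))) := by
    intro j
    induction j with
    | zero =>
      intro _
      refine ⟨fun z => z, .id, fun p hp => ?_⟩
      simp [hΦ0 p hp]
    | succ j ih =>
      intro hj
      obtain ⟨φ, hφ, hφS⟩ := ih (by omega)
      obtain ⟨ψ, hψ, hψe⟩ := exists_symplectic_euler (hf (j * τ)) (hLs _) (hC _) (hR _)
        hτ0.le hτL
      refine ⟨fun z => ψ (φ z), hψ.comp hφ, fun p hp => ?_⟩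
      have h1 := hψe (φ p)
      have h2 := hstep p hp (j * τ) ((j + 1 : ℕ) * τ) (by positivity)
        (by push_cast; nlinarith) (by
          rw [← hMτ]
          gcongr)
      rw [show ((j + 1 : ℕ) * τ - j * τ) = τ by push_cast; ring] at h2
      have h3 := hφS p hp
      have h4 : ‖hamVF (f (j * τ)) (φ p) - hamVF (f (j * τ)) (Φ p (j * τ))‖
          ≤ L * ‖φ p - Φ p (j * τ)‖ := by
        simpa [dist_eq_norm] using (hLs (j * τ)).dist_le_mul (φ p) (Φ p (j * τ))
      have h5 : ψ (φ p) - Φ p ((j + 1 : ℕ) * τ)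
          = (ψ (φ p) - φ p - τ • hamVF (f (j * τ)) (φ p))
            - (Φ p ((j + 1 : ℕ) * τ) - Φ p (j * τ) - τ • hamVF (f (j * τ)) (Φ p (j * τ)))
            + (φ p - Φ p (j * τ))
            + τ • (hamVF (f (j * τ)) (φ p) - hamVF (f (j * τ)) (Φ p (j * τ))) := by module
      have h6 : ‖τ • (hamVF (f (j * τ)) (φ p) - hamVF (f (j * τ)) (Φ p (j * τ)))‖
          ≤ τ * (L * ‖φ p - Φ p (j * τ)‖) := by
        rw [norm_smul, Real.norm_of_nonneg hτ0.le]
        gcongr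
      set c := τ * (L * (τ * C)) with hc
      have hc0 : 0 ≤ c := by positivity
      have h7 : (1 : ℝ) ≤ (1 + τ * L) ^ (j + 1) := one_le_pow₀ (by
        linarith [mul_nonneg hτ0.le (NNReal.coe_nonneg L)])
      calc ‖ψ (φ p) - Φ p ((j + 1 : ℕ) * τ)‖
          ≤ c + c + ‖φ p - Φ p (j * τ)‖ + τ * (L * ‖φ p - Φ p (j * τ)‖) := by
            rw [h5]
            exact norm_add_le_of_le (norm_add_le_of_le (norm_sub_le_of_le h1 h2) le_rfl) h6
        _ = 2 * c + (1 + τ * L) * ‖φ p - Φ p (j * τ)‖ := by ring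
        _ ≤ (1 + τ * L) ^ (j + 1) * (2 * c) + (1 + τ * L) *
            ((1 + τ * L) ^ j * (j * (2 * c))) := by
            have h8 := le_mul_of_one_le_left (mul_nonneg zero_le_two hc0) h7
            gcongr
        _ = _ := by
            push_cast
            ring
  obtain ⟨φ, hφ, hφS⟩ := key M le_rfl
  refine ⟨φ, hφ, fun p hp => ?_⟩
  have h1 := hφS p hp
  rw [hMτ] at h1
  refine h1.trans ?_
  have h2 : (1 + τ * L) ^ M ≤ Real.exp L := by
    calc (1 + τ * L) ^ M ≤ Real.exp (τ * L) ^ M := by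
          gcongr
          linarith [Real.add_one_le_exp (τ * (L : ℝ))]
      _ = Real.exp L := by
          rw [← Real.exp_nat_mul, ← mul_assoc, hMτ, one_mul]
  have h3 : Real.exp L * (2 * (L * C)) / δ ≤ M := ((le_max_right _ _).trans_lt hM).le
  rw [div_le_iff₀ hδ] at h3
  calc (1 + τ * L) ^ M * (M * (2 * (τ * (L * (τ * C)))))
      ≤ Real.exp L * (M * (2 * (τ * (L * (τ * C))))) := by gcongr
    _ = (M * τ) * τ * (Real.exp L * (2 * (L * C))) := by ring
    _ ≤ (M * τ) * τ * (M * δ) := by gcongr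
    _ = (M * τ) * (M * τ) * δ := by ring
    _ = δ := by rw [hMτ]; ring

/-- Cutting off a time-dependent function to a compactly supported one. -/
theorem exists_contDiff_cutoff {a b : ℝ} {h : Esp n × ℝ → ℝ} (ha : a < 0) (hb : 1 < b)
    (hhc : ContDiffOn ℝ ∞ h (Set.univ ×ˢ Set.Ioo a b)) (R : ℝ) :
    ∃ F : Esp n × ℝ → ℝ, ContDiff ℝ ∞ F ∧ HasCompactSupport F ∧
      ∀ q, ‖q‖ ≤ R → ∀ s ∈ Set.Icc (0 : ℝ) 1, F (q, s) = h (q, s) := by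
  let χ : ContDiffBump (0 : Esp n) := ⟨|R| + 1, |R| + 2, by positivity, by linarith⟩
  let κ : ContDiffBump (1 / 2 : ℝ) :=
    ⟨1 / 2, 1 / 2 + min (-a) (b - 1) / 2, by norm_num, by
      have : 0 < min (-a) (b - 1) := lt_min (by linarith) (by linarith)
      linarith⟩
  let F : Esp n × ℝ → ℝ := fun z => χ z.1 * (κ z.2 * h z)
  have hκ : tsupport κ ⊆ Set.Ioo a b := by
    rw [κ.tsupport_eq]
    intro s hs
    have h0 : 0 < min (-a) (b - 1) := lt_min (by linarith) (by linarith)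
    have h1 := min_le_left (-a) (b - 1)
    have h2 := min_le_right (-a) (b - 1)
    rw [Metric.mem_closedBall, Real.dist_eq, abs_le] at hs
    simp only [κ] at hs
    constructor <;> linarith [hs.1, hs.2]
  have hFs : Function.support F ⊆ tsupport χ ×ˢ tsupport κ := by
    intro z hz
    rw [Function.mem_support] at hz
    exact ⟨subset_tsupport _ (left_ne_zero_of_mul hz),
      subset_tsupport _ (left_ne_zero_of_mul (right_ne_zero_of_mul hz))⟩
  have hcl : IsClosed (tsupport χ ×ˢ tsupport κ) :=
    (isClosed_tsupport _).prod (isClosed_tsupport _)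
  have hFcpt : HasCompactSupport F :=
    HasCompactSupport.of_support_subset_isCompact
      (χ.hasCompactSupport.isCompact.prod κ.hasCompactSupport.isCompact) hFs
  have hF : ContDiff ℝ ∞ F := by
    refine contDiff_iff_contDiffAt.2 fun z => ?_
    by_cases hz : z ∈ tsupport F
    swap
    · exact contDiffAt_const.congr_of_eventuallyEq (notMem_tsupport_iff_eventuallyEq.1 hz)
    have hz2 := (closure_minimal hFs hcl hz).2
    have h1 : ContDiffAt ℝ ∞ h z := hhc.contDiffAt
      ((isOpen_univ.prod isOpen_Ioo).mem_nhds ⟨Set.mem_univ _, hκ hz2⟩)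
    exact ((χ.contDiff.comp contDiff_fst).contDiffAt).mul
      (((κ.contDiff.comp contDiff_snd).contDiffAt).mul h1)
  refine ⟨F, hF, hFcpt, fun q hq s hs => ?_⟩
  have h2 : χ q = 1 := χ.one_of_mem_closedBall (by
    rw [mem_closedBall_zero_iff]
    exact hq.trans ((le_abs_self R).trans (lt_add_one _).le))
  have h3 : κ s = 1 := κ.one_of_mem_closedBall (by
    rw [Metric.mem_closedBall, Real.dist_eq, abs_le]
    change -(1 / 2 : ℝ) ≤ s - 1 / 2 ∧ s - 1 / 2 ≤ 1 / 2
    constructor <;> linarith [hs.1, hs.2])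
  simp only [F, h2, h3, one_mul]

theorem exists_lipschitz_hamVF {F : Esp n × ℝ → ℝ} (hF : ContDiff ℝ ∞ F)
    (hFcpt : HasCompactSupport F) :
    ∃ (L : NNReal) (C R : ℝ),
      LipschitzWith L (fun z : Esp n × ℝ => hamVF (fun q => F (q, z.2)) z.1) ∧ 1 ≤ C ∧ (∀ s z, ‖hamVF (fun q => F (q, s)) z‖ ≤ C) ∧
      ∀ s z, R < ‖z‖ → hamVF (fun q => F (q, s)) z = 0 := by
  have hFd : Differentiable ℝ F := hF.differentiable (by norm_num)
  have hslice (s : ℝ) : ContDiff ℝ ∞ fun q => F (q, s) := hF.comp (by fun_prop)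
  let V : Esp n × ℝ → Esp n := fun z => hamLin n ((fderiv ℝ F z).comp (.inl ℝ _ _))
  have hV (z : Esp n × ℝ) : hamVF (fun q => F (q, z.2)) z.1 = V z := by
    rw [hamVF_eq_hamLin ((hslice z.2).differentiable (by norm_num) _)]
    congr 1
    exact (HasFDerivAt.comp (f := fun q => (q, z.2)) z.1 (hFd z).hasFDerivAt
      (hasFDerivAt_prodMk_left _ _)).fderiv
  have hVc : ContDiff ℝ 1 V := by
    have h1 : ContDiff ℝ 1 (fderiv ℝ F) := hF.fderiv_right (by norm_cast)
    exact (hamLin n).contDiff.comp (h1.clm_comp contDiff_const)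
  have hVs : HasCompactSupport V := (hFcpt.fderiv (𝕜 := ℝ)).mono fun z hz h0 => hz <| by
    simp only [V, h0, ContinuousLinearMap.zero_comp, map_zero]
  obtain ⟨L, hL⟩ := hVc.lipschitzWith_of_hasCompactSupport hVs (by norm_num)
  obtain ⟨C, hC⟩ := hVs.exists_bound_of_continuous hVc.continuous
  obtain ⟨R', hR'⟩ : ∃ R' : ℝ, ∀ z, R' < ‖z‖ → V z = 0 := by
    obtain ⟨R', h⟩ := hVs.isCompact.isBounded.exists_norm_le
    exact ⟨R', fun z hz => by_contra fun hne => (h z (subset_tsupport _ hne)).not_gt hz⟩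
  refine ⟨L, max C 1, R', ?_, le_max_right _ _, fun s z => ?_, fun s z hz => ?_⟩
  · rwa [funext hV]
  · rw [hV (z, s)]
    exact (hC _).trans (le_max_left _ _)
  · rw [hV (z, s)]
    exact hR' _ (hz.trans_le (le_max_left _ _))

/-- The time-one map of a Hamiltonian isotopy is, on compact sets, uniformly approximated by
compactly supported symplectic maps. -/
theorem exists_symplectic_approx {a b : ℝ} {Φ : Esp n × ℝ → Esp n} {h : Esp n × ℝ → ℝ}
    (ha : a < 0) (hb : 1 < b) (hΦc : ContDiffOn ℝ ∞ Φ (Set.univ ×ˢ Set.Ioo a b))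
    (hhc : ContDiffOn ℝ ∞ h (Set.univ ×ˢ Set.Ioo a b)) (hΦ0 : ∀ p, Φ (p, 0) = p)
    (hΦ : ∀ p, ∀ s ∈ Set.Ioo a b,
      HasDerivAt (fun t => Φ (p, t)) (hamVF (fun q => h (q, s)) (Φ (p, s))) s)
    {S : Set (Esp n)} (hS : IsCompact S) {δ : ℝ} (hδ : 0 < δ) :
    ∃ φ : Esp n → Esp n, IsSymplecticCompact φ ∧ ∀ p ∈ S, ‖φ p - Φ (p, 1)‖ ≤ δ := by
  have hIcc : Set.Icc (0 : ℝ) 1 ⊆ Set.Ioo a b := fun s hs => ⟨ha.trans_le hs.1, hs.2.trans_lt hb⟩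
  obtain ⟨R, hR⟩ : ∃ R : ℝ, ∀ p ∈ S, ∀ s ∈ Set.Icc (0 : ℝ) 1, ‖Φ (p, s)‖ ≤ R := by
    obtain ⟨R, h⟩ := ((hS.prod (isCompact_Icc (a := (0 : ℝ)) (b := 1))).bddAbove_image
      (f := fun z => ‖Φ z‖) ((hΦc.continuousOn.mono
        (Set.prod_mono (Set.subset_univ _) hIcc)).norm))
    exact ⟨R, fun p hp s hs => h ⟨(p, s), ⟨hp, hs⟩, rfl⟩⟩
  obtain ⟨F, hF, hFcpt, hFh⟩ := exists_contDiff_cutoff ha hb hhc (R + 1)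
  have hslice (s : ℝ) : ContDiff ℝ ∞ fun q => F (q, s) := hF.comp (by fun_prop)
  obtain ⟨L, C, R', hL, hC1, hC, hR'⟩ := exists_lipschitz_hamVF hF hFcpt
  refine exists_symplectic_approx_of_lipschitz (fun s => (hslice s).of_le (by norm_cast)) hL hC1
    hC hR' (Φ := fun p s => Φ (p, s)) (fun p _ => hΦ0 p) (fun p hp s hs => ?_) hδ
  refine (hΦ p s (hIcc hs)).congr_deriv ?_
  have hev : (fun q => F (q, s)) =ᶠ[nhds (Φ (p, s))] fun q => h (q, s) := by
    have h1 : ‖Φ (p, s)‖ < R + 1 := (hR p hp s hs).trans_lt (lt_add_one _)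
    filter_upwards [Metric.isOpen_ball.mem_nhds (mem_ball_zero_iff.2 h1)] with q hq
    exact hFh q (mem_ball_zero_iff.1 hq).le s hs
  have hd := (hslice s).differentiable (by norm_num) (Φ (p, s))
  rw [hamVF_eq_hamLin hd, hamVF_eq_hamLin (hd.congr_of_eventuallyEq hev.symm), hev.fderiv_eq]

/-- A monotone function of one variable whose shear sweeps out the disc of radius `ρ`. -/
theorem exists_disc_shear {ρ : ℝ} (hρ : 0 < ρ) :
    ∃ w w' : ℝ → ℝ, (∀ x, HasDerivAt w (w' x) x) ∧ UniformContinuous w' ∧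
      (∀ x, 0 ≤ w x ∧ w x ≤ Real.pi * ρ ^ 2) ∧ (∀ x, 0 ≤ w' x ∧ w' x ≤ 2 * ρ) ∧
      ∀ x, x ^ 2 ≤ ρ ^ 2 → w' x = 2 * √(ρ ^ 2 - x ^ 2) := by
  let g : ℝ → ℝ := fun t => √(1 - t ^ 2)
  have hg : Continuous g := by fun_prop
  have hg0 (t : ℝ) : 0 ≤ g t := Real.sqrt_nonneg _
  have hg1 (t : ℝ) : g t ≤ 1 := Real.sqrt_le_one.2 (by nlinarith [sq_nonneg t])
  have hgz (t : ℝ) (ht : 1 ≤ |t|) : g t = 0 :=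
    Real.sqrt_eq_zero_of_nonpos (by nlinarith [sq_abs t])
  let W : ℝ → ℝ := fun x => ∫ t in (-1 : ℝ)..x, g t
  have hW (x : ℝ) : HasDerivAt W (g x) x :=
    intervalIntegral.integral_hasDerivAt_right (hg.intervalIntegrable _ _)
      hg.aestronglyMeasurable.stronglyMeasurableAtFilter hg.continuousAt
  have hWm : Monotone W := monotone_of_hasDerivAt_nonneg hW hg0
  have hWl (x : ℝ) (hx : x ≤ -1) : W x = 0 := by
    have : ∀ t ∈ Set.uIcc (-1) x, g t = 0 := fun t ht => by
      rw [Set.uIcc_of_ge hx] at ht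
      exact hgz t (by rw [abs_of_nonpos (by linarith [ht.2])]; linarith [ht.2])
    simpa using intervalIntegral.integral_congr this
  have hWr (x : ℝ) (hx : 1 ≤ x) : W x = Real.pi / 2 := by
    have h1 : ∫ t in (1 : ℝ)..x, g t = 0 := by
      have : ∀ t ∈ Set.uIcc 1 x, g t = 0 := fun t ht => by
        rw [Set.uIcc_of_le hx] at ht
        exact hgz t (by rw [abs_of_nonneg (by linarith [ht.1])]; linarith [ht.1])
      simpa using intervalIntegral.integral_congr this
    have h2 := intervalIntegral.integral_add_adjacent_intervals (μ := MeasureTheory.volume)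
      (hg.intervalIntegrable (-1) 1) (hg.intervalIntegrable 1 x)
    simp only [W]
    rw [← h2, h1, add_zero]
    exact integral_sqrt_one_sub_sq
  have hgu : UniformContinuous g := by
    refine HasCompactSupport.uniformContinuous_of_continuous ?_ hg
    refine HasCompactSupport.intro (isCompact_Icc (a := (-1 : ℝ)) (b := 1)) fun t ht => hgz t ?_
    by_contra! h
    exact ht (abs_le.1 h.le)
  have hdiv : UniformContinuous fun x : ℝ => x / ρ := by
    simp only [div_eq_mul_inv]
    exact uniformContinuous_id.mul_const' _
  refine ⟨fun x => 2 * ρ ^ 2 * W (x / ρ), fun x => 2 * ρ * g (x / ρ), fun x => ?_, ?_,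
    fun x => ⟨?_, ?_⟩, fun x => ⟨?_, ?_⟩, fun x hx => ?_⟩
  · refine (((hW (x / ρ)).comp x ((hasDerivAt_id x).div_const ρ)).const_mul
      (2 * ρ ^ 2)).congr_deriv ?_
    field_simp
  · exact (hgu.comp hdiv).const_mul' _
  · have h1 : 0 ≤ W (x / ρ) := by
      rw [← hWl (min (x / ρ) (-1)) (min_le_right _ _)]
      exact hWm (min_le_left _ _)
    positivity
  · have h1 : W (x / ρ) ≤ Real.pi / 2 := by
      rw [← hWr (max (x / ρ) 1) (le_max_right _ _)]
      exact hWm (le_max_left _ _)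
    nlinarith [sq_nonneg ρ]
  · have := hg0 (x / ρ)
    positivity
  · nlinarith [hg1 (x / ρ)]
  · have h1 : 1 - (x / ρ) ^ 2 = (ρ ^ 2 - x ^ 2) / ρ ^ 2 := by field_simp
    simp only [g]
    rw [h1, Real.sqrt_div (by linarith), Real.sqrt_sq hρ.le]
    field_simp

/-- The Hamiltonian of a compactly cut off shear in the first symplectic plane. -/
theorem exists_shear_hamiltonian (i : Fin n) {w w' : ℝ → ℝ} (hw : ∀ x, HasDerivAt w (w' x) x)
    (hw' : Continuous w') {c : ℝ} (hc : ∀ x, 0 ≤ w x ∧ w x ≤ c) (B : ℝ) :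
    ∃ K : Esp n → ℝ, ContDiff ℝ 1 K ∧ HasCompactSupport K ∧ (∀ y, 0 ≤ K y ∧ K y ≤ c) ∧
      ∀ y, ‖y‖ ≤ B → hamVF K y = (0, -(w' (y.1 i)) • EuclideanSpace.single i 1) := by
  let χ : ContDiffBump (0 : Esp n) := ⟨|B| + 1, |B| + 2, by positivity, by linarith⟩
  have hwc : ContDiff ℝ 1 w := by
    rw [contDiff_one_iff_deriv]
    refine ⟨fun s => (hw s).differentiableAt, ?_⟩
    rwa [show deriv w = w' from funext fun s => (hw s).deriv]
  let P : Esp n →L[ℝ] ℝ := (EuclideanSpace.proj i).comp (.fst ℝ _ _)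
  refine ⟨fun y => χ y * w (P y), χ.contDiff.mul (hwc.comp P.contDiff),
    χ.hasCompactSupport.mul_right, fun y => ⟨mul_nonneg χ.nonneg (hc _).1, ?_⟩, fun y hy => ?_⟩
  · exact (mul_le_of_le_one_left (hc _).1 χ.le_one).trans (hc _).2
  · have hev : (fun y => χ y * w (P y)) =ᶠ[nhds y] fun y => w (P y) := by
      have h1 : ‖y‖ < |B| + 1 := (hy.trans (le_abs_self B)).trans_lt (lt_add_one _)
      filter_upwards [Metric.isOpen_ball.mem_nhds (mem_ball_zero_iff.2 h1)] with q hq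
      have h2 : χ q = 1 := χ.one_of_mem_closedBall (Metric.ball_subset_closedBall hq)
      rw [h2, one_mul]
    have hd : HasFDerivAt (fun y => χ y * w (P y)) (w' (P y) • P) y :=
      ((hw (P y)).comp_hasFDerivAt y P.hasFDerivAt).congr_of_eventuallyEq hev
    refine Prod.ext (ext_inner_right ℝ fun v => ?_) (ext_inner_right ℝ fun v => ?_)
    · rw [inner_hamVF_fst hd.differentiableAt, hd.fderiv]
      simp [P]
    · rw [inner_hamVF_snd hd.differentiableAt, hd.fderiv]
      simp [P, real_inner_smul_left, EuclideanSpace.inner_single_left]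

/-- Consistency of the conjugated symplectic Euler scheme. -/
theorem IsSymplecticCompact.exists_consistency {φ : Esp n → Esp n} (hφ : IsSymplecticCompact φ)
    {K : Esp n → ℝ} (hK : ContDiff ℝ 1 K) (hKs : HasCompactSupport K) :
    ContDiff ℝ 1 (fun z => K (φ z)) ∧ (∃ C, ∀ z, ‖fderiv ℝ (fun z => K (φ z)) z‖ ≤ C) ∧
    ∀ e > 0, ∃ δ > 0, ∀ τ : ℝ, 0 < τ → τ < δ → ∀ z z' : Esp n,
      z' = z + τ • hamVF (fun z => K (φ z)) (z.1, z'.2) →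
      ‖φ z' - φ z - τ • hamVF K (φ z)‖ ≤ τ * e := by
  set G : Esp n → ℝ := fun z => K (φ z) with hGdef
  obtain ⟨R, hR⟩ := hφ.eq_self
  have hGc : ContDiff ℝ 1 G := hK.comp hφ.contDiff
  have hKd : Differentiable ℝ K := hK.differentiable (by norm_num)
  have hGd : Differentiable ℝ G := hGc.differentiable (by norm_num)
  have hφd : Differentiable ℝ φ := hφ.contDiff.differentiable (by norm_num)
  have hGs : HasCompactSupport G := by
    obtain ⟨R', hR'⟩ := hKs.isCompact.isBounded.exists_norm_le
    refine HasCompactSupport.intro (isCompact_closedBall (0 : Esp n) (max R R')) fun z hz => ?_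
    rw [mem_closedBall_zero_iff, not_le, max_lt_iff] at hz
    simp only [hGdef, hR z hz.1]
    exact by_contra fun hne => (hR' z (subset_tsupport _ hne)).not_gt hz.2
  have hdG : Continuous (fderiv ℝ G) := hGc.continuous_fderiv (by norm_num)
  obtain ⟨C, hC⟩ := (hGs.fderiv (𝕜 := ℝ)).exists_bound_of_continuous hdG
  refine ⟨hGc, ⟨C, hC⟩, fun e he => ?_⟩
  have hC0 : 0 ≤ C := (norm_nonneg _).trans (hC 0)
  have hX (z : Esp n) : hamVF G z = hamLin n (fderiv ℝ G z) := hamVF_eq_hamLin (hGd z)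
  have hXu : UniformContinuous (hamVF G) := by
    rw [funext hX]
    exact (hamLin n).uniformContinuous.comp
      ((hGs.fderiv (𝕜 := ℝ)).uniformContinuous_of_continuous hdG)
  obtain ⟨C', hC'0, hC'⟩ : ∃ C' : ℝ, 0 < C' ∧ ∀ z, ‖hamVF G z‖ ≤ C' := by
    refine ⟨‖hamLin n‖ * C + 1, by positivity, fun z => ?_⟩
    rw [hX]
    exact ((hamLin n).le_opNorm_of_le (hC z)).trans (lt_add_one _).le
  have hdφ : Continuous (fderiv ℝ φ) := hφ.contDiff.continuous_fderiv (by norm_num)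
  have hdφs : HasCompactSupport fun z => fderiv ℝ φ z - .id ℝ (Esp n) := by
    refine HasCompactSupport.intro (isCompact_closedBall (0 : Esp n) R) fun z hz => ?_
    rw [mem_closedBall_zero_iff, not_le] at hz
    have h1 : φ =ᶠ[nhds z] fun z => z := by
      filter_upwards [(isOpen_lt continuous_const continuous_norm).mem_nhds hz] with q hq
        using hR q hq
    rw [h1.fderiv_eq, fderiv_fun_id, sub_self]
  have hdφc : Continuous fun z => fderiv ℝ φ z - .id ℝ (Esp n) := hdφ.sub continuous_const
  have hdφu : UniformContinuous (fderiv ℝ φ) := by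
    have := (hdφs.uniformContinuous_of_continuous hdφc).add
      (uniformContinuous_const (b := ContinuousLinearMap.id ℝ (Esp n)))
    simpa using this
  obtain ⟨A, hA0, hA⟩ : ∃ A : ℝ, 0 < A ∧ ∀ z, ‖fderiv ℝ φ z‖ ≤ A := by
    obtain ⟨A, hA⟩ := hdφs.exists_bound_of_continuous hdφc
    have hA0 : 0 ≤ A := (norm_nonneg _).trans (hA 0)
    refine ⟨A + ‖ContinuousLinearMap.id ℝ (Esp n)‖ + 1, by positivity, fun z => ?_⟩
    have := norm_add_le_of_le (hA z) (le_refl ‖ContinuousLinearMap.id ℝ (Esp n)‖)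
    rw [sub_add_cancel] at this
    linarith
  obtain ⟨δ₁, hδ₁, h₁⟩ := Metric.uniformContinuous_iff.1 hXu (e / (2 * A)) (by positivity)
  obtain ⟨δ₂, hδ₂, h₂⟩ := Metric.uniformContinuous_iff.1 hdφu (e / (2 * C')) (by positivity)
  refine ⟨min δ₁ δ₂ / C', by positivity, fun τ hτ hτδ z z' hz => ?_⟩
  rw [lt_div_iff₀ hC'0, lt_min_iff] at hτδ
  have hzz : ‖z' - z‖ ≤ τ * C' := by
    rw [sub_eq_iff_eq_add'.2 hz, norm_smul, Real.norm_of_nonneg hτ.le]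
    gcongr
    exact hC' _
  have hmid : dist ((z.1, z'.2) : Esp n) z ≤ τ * C' := by
    refine le_trans ?_ hzz
    rw [Prod.dist_eq, dist_self, ← dist_eq_norm]
    exact max_le dist_nonneg (le_max_right _ _)
  have h3 : ‖φ z' - φ z - fderiv ℝ φ z (z' - z)‖ ≤ e / (2 * C') * ‖z' - z‖ := by
    refine (convex_segment z z').norm_image_sub_le_of_norm_hasFDerivWithin_le'
      (fun u _ => (hφd u).hasFDerivAt.hasFDerivWithinAt) (fun u hu => ?_)
      (left_mem_segment ℝ z z') (right_mem_segment ℝ z z')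
    rw [← dist_eq_norm]
    refine (h₂ ?_).le
    rw [dist_eq_norm]
    exact ((norm_sub_le_of_mem_segment hu).trans hzz).trans_lt hτδ.2
  have h4 : φ z' - φ z - τ • hamVF K (φ z) = (φ z' - φ z - fderiv ℝ φ z (z' - z))
      + τ • fderiv ℝ φ z (hamVF G (z.1, z'.2) - hamVF G z) := by
    rw [map_sub (fderiv ℝ φ z) (hamVF G _), hφ.fderiv_hamVF hKd, smul_sub,
      ← map_smul (fderiv ℝ φ z), ← sub_eq_iff_eq_add'.2 hz]
    abel
  have h5 : ‖fderiv ℝ φ z (hamVF G (z.1, z'.2) - hamVF G z)‖ ≤ A * (e / (2 * A)) := by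
    refine ContinuousLinearMap.le_of_opNorm_le_of_le _ (hA z) ?_
    rw [← dist_eq_norm]
    exact (h₁ (hmid.trans_lt hτδ.1)).le
  rw [h4]
  refine (norm_add_le _ _).trans ?_
  rw [norm_smul, Real.norm_of_nonneg hτ.le]
  calc _ ≤ e / (2 * C') * (τ * C') + τ * (A * (e / (2 * A))) := by
        gcongr
        exact h3.trans (by gcongr)
    _ = τ * e := by
        field_simp
        ring

theorem abs_fst_apply_le (y : Esp n) (i : Fin n) : |y.1 i| ≤ ‖y‖ :=
  (PiLp.norm_apply_le y.1 i).trans (norm_fst_le y)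

theorem abs_snd_apply_le (y : Esp n) (i : Fin n) : |y.2 i| ≤ ‖y‖ :=
  (PiLp.norm_apply_le y.2 i).trans (norm_snd_le y)

/-- Approximate Euler orbits of a cut off shear displace the second coordinate as the shear. -/
theorem euler_orbit_shear (i : Fin n) {X : Esp n → Esp n} {w' : ℝ → ℝ} {B : ℝ}
    (hX : ∀ y, ‖y‖ ≤ B → X y = (0, -(w' (y.1 i)) • EuclideanSpace.single i 1))
    (hw : ∀ x, 0 ≤ w' x ∧ w' x ≤ 2) {e e₁ : ℝ} (he : e ≤ 1) (he₁ : 0 ≤ e₁) (hee : e₁ ≤ e)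
    (hu : ∀ x x', |x - x'| ≤ e₁ → |w' x - w' x'| ≤ e) {τ : ℝ} (hτ : 0 ≤ τ) {N : ℕ}
    (hN : N * τ = 1) {y : ℕ → Esp n} (hB : ‖y 0‖ + 3 ≤ B)
    (hy : ∀ k < N, ‖y (k + 1) - y k - τ • X (y k)‖ ≤ τ * e₁) :
    |(y N).1 i - (y 0).1 i| ≤ e₁ ∧ (y N).2 i ≤ (y 0).2 i - (w' ((y 0).1 i) - 2 * e) := by
  have key : ∀ k ≤ N, ‖y k‖ ≤ ‖y 0‖ + 3 * (k * τ) ∧ |(y k).1 i - (y 0).1 i| ≤ k * τ * e₁ ∧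
      (y k).2 i ≤ (y 0).2 i - k * τ * (w' ((y 0).1 i) - 2 * e) := by
    intro k hk
    induction k with
    | zero => simp
    | succ k ih =>
      obtain ⟨h1, h2, h3⟩ := ih (by omega)
      have hkτ : (k : ℝ) * τ ≤ 1 := by
        rw [← hN]
        gcongr
        omega
      have hyk : ‖y k‖ ≤ B := by linarith
      have h4 := hy k (by omega)
      set d := y (k + 1) - y k - τ • X (y k) with hd
      have h5 : y (k + 1) = y k + τ • X (y k) + d := by rw [hd]; abel
      have hXk := hX _ hyk
      have h6 : (y (k + 1)).1 i = (y k).1 i + d.1 i := by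
        rw [h5, hXk]
        simp
      have h7 : (y (k + 1)).2 i = (y k).2 i - τ * w' ((y k).1 i) + d.2 i := by
        rw [h5, hXk]
        simp [sub_eq_add_neg]
      have h8 : ‖X (y k)‖ ≤ 2 := by
        rw [hXk, Prod.norm_mk, norm_zero, norm_smul, norm_neg,
          Real.norm_of_nonneg (hw _).1, PiLp.norm_single, norm_one, mul_one]
        exact max_le (by norm_num) (hw _).2
      have h9 : ‖y (k + 1)‖ ≤ ‖y k‖ + τ * 2 + τ * e₁ := by
        rw [h5]
        refine norm_add_le_of_le (norm_add_le_of_le le_rfl ?_) h4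
        rw [norm_smul, Real.norm_of_nonneg hτ]
        gcongr
      have h10 := (abs_fst_apply_le d i).trans h4
      have h11 := (abs_le.1 ((abs_snd_apply_le d i).trans h4)).2
      have h12 := (abs_le.1 (hu _ _ (h2.trans (mul_le_of_le_one_left he₁ hkτ)))).1
      refine ⟨?_, ?_, ?_⟩
      · push_cast
        nlinarith
      · rw [h6, add_sub_right_comm]
        refine (abs_add_le _ _).trans ?_
        push_cast
        linarith
      · rw [h7]
        push_cast
        nlinarith
  obtain ⟨-, h1, h2⟩ := key N le_rfl
  rw [hN, one_mul] at h1 h2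
  exact ⟨h1, h2⟩

/-- A chord of the disc of radius `ρ` is too long for a smaller concentric disc. -/
theorem shear_gap {ρ c a b a' b' : ℝ} (hρ : ρ ^ 2 < 1 / 2) (hc : c < ρ ^ 2)
    (h : a ^ 2 + b ^ 2 < c) (h' : a' ^ 2 + b' ^ 2 < c) (ha : |a' - a| ≤ (ρ ^ 2 - c) / 8)
    (hb : b' ≤ b - (2 * √(ρ ^ 2 - a ^ 2) - 2 * ((ρ ^ 2 - c) / 8))) : False := by
  set P := √(ρ ^ 2 - a ^ 2)
  have hP : P ^ 2 = ρ ^ 2 - a ^ 2 := Real.sq_sqrt (by nlinarith [sq_nonneg b])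
  have hP0 : 0 ≤ P := Real.sqrt_nonneg _
  have hP1 : P ≤ 1 := by nlinarith [sq_nonneg a]
  obtain ⟨m, hm⟩ : ∃ m, m = ρ ^ 2 - c := ⟨_, rfl⟩
  rw [← hm] at ha hb
  have hPm : m ≤ P := by nlinarith [sq_nonneg b]
  have hsq : P ^ 2 - m / 2 ≤ (P - m / 4) ^ 2 := by nlinarith
  have ha1 : |a| ≤ 1 := abs_le_one_iff_mul_self_le_one.2 (by nlinarith [sq_nonneg b])
  obtain ⟨h1, h2⟩ := abs_le.1 ha1
  obtain ⟨h3, h4⟩ := abs_le.1 ha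
  have ha2 : a ^ 2 - m / 4 ≤ a' ^ 2 := by
    nlinarith [sq_nonneg (a' - a), mul_nonneg (sub_nonneg.2 h2) (sub_nonneg.2 h3),
      mul_nonneg (sub_nonneg.2 h1) (sub_nonneg.2 h4),
      mul_nonneg (sub_nonneg.2 h1) (sub_nonneg.2 h3),
      mul_nonneg (sub_nonneg.2 h2) (sub_nonneg.2 h4)]
  have hb1 : b < P - m / 4 := lt_of_pow_lt_pow_left₀ 2 (by linarith) (by nlinarith)
  have hb2 : -b' < P - m / 4 := lt_of_pow_lt_pow_left₀ 2 (by linarith) (by nlinarith)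
  linarith

/-- A compactly supported symplectomorphism cannot move the saucer into a thin cylinder. -/
theorem IsSymplecticCompact.not_squeeze {φ : Esp n → Esp n} (hφ : IsSymplecticCompact φ)
    (i : Fin n) {c : ℝ} (hc : c < 1 / 2)
    (h : ∀ p ∈ saucer n, (φ p).1 i ^ 2 + (φ p).2 i ^ 2 < c) : False := by
  have h0 : (0 : Esp n) ∈ saucer n := Or.inr ⟨rfl, by simp⟩
  have hc0 : 0 < c := lt_of_le_of_lt (by positivity) (h 0 h0)
  obtain ⟨ρ, hρ0, hρ⟩ : ∃ ρ : ℝ, 0 < ρ ∧ ρ ^ 2 = (c + 1 / 2) / 2 :=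
    ⟨√((c + 1 / 2) / 2), by positivity, Real.sq_sqrt (by positivity)⟩
  have hcρ : c < ρ ^ 2 := by linarith
  have hρ2 : ρ ^ 2 < 1 / 2 := by linarith
  have hρ1 : 2 * ρ ≤ 2 := by nlinarith
  have hφc : Continuous φ := hφ.contDiff.continuous
  obtain ⟨B, hB⟩ := isCompact_saucer.exists_bound_of_continuousOn (f := φ) hφc.continuousOn
  let U : Set (Esp n) := {z | (φ z).1 i ^ 2 + (φ z).2 i ^ 2 < c ∧ ‖φ z‖ < B + 1}
  have hU : IsOpen U :=
    (isOpen_lt (f := fun z => (φ z).1 i ^ 2 + (φ z).2 i ^ 2) (by fun_prop) continuous_const).inter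
      (isOpen_lt hφc.norm continuous_const)
  obtain ⟨ε₀, hε₀, hεU⟩ := exists_smoothSaucer_subset hU
    fun p hp => ⟨h p hp, (hB p hp).trans_lt (lt_add_one _)⟩
  obtain ⟨w, w', hw, hwu, hwb, hwb', hws⟩ := exists_disc_shear hρ0
  obtain ⟨K, hK, hKs, hKb, hKX⟩ :=
    exists_shear_hamiltonian i hw hwu.continuous hwb (B + 4)
  obtain ⟨hG, ⟨C, hC⟩, hcons⟩ := hφ.exists_consistency hK hKs
  set e := (ρ ^ 2 - c) / 8 with he
  have he0 : 0 < e := by linarith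
  obtain ⟨η, hη, hηu⟩ := Metric.uniformContinuous_iff.1 hwu e he0
  obtain ⟨δ, hδ, hcons⟩ := hcons (min e (η / 2)) (by positivity)
  obtain ⟨N, hN⟩ := exists_nat_gt δ⁻¹
  have hN0 : (0 : ℝ) < N := (inv_pos.2 hδ).trans hN
  have hgap : 0 < Real.pi / 2 - Real.pi * ρ ^ 2 := by nlinarith [Real.pi_pos]
  obtain ⟨ε, hε, hεlt⟩ := exists_between
    (lt_min hε₀ (by positivity : 0 < (Real.pi / 2 - Real.pi * ρ ^ 2) / 2))
  rw [lt_min_iff] at hεlt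
  obtain ⟨z, hz0, hzN, hz⟩ := exists_discrete_trajectory hG hε (Nat.cast_pos.1 hN0) hC
    (fun p => (hKb _).1) (fun p => (hKb _).2) (by linarith)
  have hz0U := hεU ε hε hεlt.1 hz0
  have hzNU := hεU ε hε hεlt.1 hzN
  have horb := euler_orbit_shear i hKX (fun x => ⟨(hwb' x).1, (hwb' x).2.trans hρ1⟩)
    (e := e) (e₁ := min e (η / 2)) (by linarith) (by positivity) (min_le_left _ _)
    (fun x x' hx => (hηu (by
      rw [Real.dist_eq]
      exact (hx.trans (min_le_right _ _)).trans_lt (by linarith))).le)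
    (inv_nonneg.2 hN0.le) (mul_inv_cancel₀ hN0.ne') (y := fun k => φ (z k))
    (by linarith [hz0U.2])
    (fun k hk => hcons _ (inv_pos.2 hN0) (inv_lt_of_inv_lt₀ hδ hN) _ _ (hz k hk))
  obtain ⟨h1, h2⟩ := horb
  have h3 : (φ (z 0)).1 i ^ 2 ≤ ρ ^ 2 := by nlinarith [hz0U.1, sq_nonneg ((φ (z 0)).2 i)]
  rw [hws _ h3] at h2
  exact shear_gap hρ2 hcρ hz0U.1 hzNU.1 (h1.trans (min_le_left _ _)) h2

end

end FlyingSaucer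

/-- nonsqueezing for the flying saucer `Λ₀`.  For `0 < r < 1/√2` there is no
Hamiltonian isotopy (defined on an open interval containing `0` and `1`) whose time-one map
sends `Λ₀` into the cylinder `{(x,ξ) : x₁² + ξ₁² ≤ r²}`. -/
theorem stmt_2 (n : ℕ) (hn : 1 ≤ n) (r : ℝ) (hr0 : 0 < r) (hr1 : r < 1 / Real.sqrt 2) :
    ¬ ∃ (a b : ℝ) (Φ : Esp n × ℝ → Esp n) (h : Esp n × ℝ → ℝ),
        a < 0 ∧ 1 < b ∧
        ContDiffOn ℝ ∞ Φ (Set.univ ×ˢ Set.Ioo a b) ∧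
        ContDiffOn ℝ ∞ h (Set.univ ×ˢ Set.Ioo a b) ∧
        (∀ p : Esp n, Φ (p, 0) = p) ∧
        (∀ (p : Esp n), ∀ s ∈ Set.Ioo a b,
          HasDerivAt (fun t => Φ (p, t)) (hamVF (fun q => h (q, s)) (Φ (p, s))) s) ∧
        (∀ p ∈ saucer n,
          (Φ (p, 1)).1 ⟨0, hn⟩ ^ 2 + (Φ (p, 1)).2 ⟨0, hn⟩ ^ 2 ≤ r ^ 2) := by
  rintro ⟨a, b, Φ, h, ha, hb, hΦc, hhc, hΦ0, hΦ, hsq⟩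
  have hr2 : r ^ 2 < 1 / 2 := by
    have := pow_lt_pow_left₀ hr1 hr0.le two_ne_zero
    rwa [div_pow, Real.sq_sqrt zero_le_two, one_pow] at this
  obtain ⟨c, hrc, hc⟩ := exists_between hr2
  obtain ⟨φ, hφ, hφΦ⟩ := FlyingSaucer.exists_symplectic_approx ha hb hΦc hhc hΦ0 hΦ
    FlyingSaucer.isCompact_saucer (δ := (c - r ^ 2) / 12) (by linarith)
  refine hφ.not_squeeze ⟨0, hn⟩ hc fun p hp => ?_
  have h1 := hsq p hp
  have h2 := abs_le.1 ((FlyingSaucer.abs_fst_apply_le _ ⟨0, hn⟩).trans (hφΦ p hp))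
  have h3 := abs_le.1 ((FlyingSaucer.abs_snd_apply_le _ ⟨0, hn⟩).trans (hφΦ p hp))
  simp only [Prod.fst_sub, Prod.snd_sub, PiLp.sub_apply] at h2 h3
  have key {x y d : ℝ} (hd : d ≤ 1) (hy : y ^ 2 ≤ 1) (hl : -d ≤ x - y) (hu : x - y ≤ d) :
      x ^ 2 ≤ y ^ 2 + 3 * d := by
    obtain ⟨hy1, hy2⟩ := abs_le.1 ((sq_le_one_iff_abs_le_one y).1 hy)
    nlinarith [mul_nonneg (sub_nonneg.2 hl) (sub_nonneg.2 hu),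
      mul_nonneg (sub_nonneg.2 hy1) (sub_nonneg.2 hu),
      mul_nonneg (sub_nonneg.2 hy2) (sub_nonneg.2 hl),
      mul_nonneg (sub_nonneg.2 hy1) (sub_nonneg.2 hl),
      mul_nonneg (sub_nonneg.2 hy2) (sub_nonneg.2 hu)]
  have hd : (c - r ^ 2) / 12 ≤ 1 := by linarith [sq_nonneg r]
  have h4 := key hd (by nlinarith [sq_nonneg ((Φ (p, 1)).2 ⟨0, hn⟩)]) h2.1 h2.2
  have h5 := key hd (by nlinarith [sq_nonneg ((Φ (p, 1)).1 ⟨0, hn⟩)]) h3.1 h3.2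
  linarith
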